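/- Let L be any bimodal logic such that L contains the commutator [K4.3, Diff] and the product frame ⟨ω+1,>⟩ × ⟨ω,≠⟩ is a frame for L (i.e. validates every formula of L). Then the L-satisfiability problem — given a bimodal formula φ, is there a model M such that M ⊨ L and φ is satisfied in M — is undecidable (the counter-machine non-termination problem, which is Π₁⁰-hard, is computably many-one reducible to it). -/

import Mathlib

namespace HK

/-! ## Bimodal formulas -/

/-- Bimodal formulas: `φ ::= P | ¬φ | φ∧ψ | ◇₀φ | ◇₁φ`. -/
inductive BForm : Type
  | var : ℕ → BForm
  | neg : BForm → BForm
  | and : BForm → BForm → BForm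
  | dia0 : BForm → BForm
  | dia1 : BForm → BForm

namespace BForm

def imp (φ ψ : BForm) : BForm := neg (and φ (neg ψ))
def bot : BForm := and (var 0) (neg (var 0))
def top : BForm := neg bot
def box0 (φ : BForm) : BForm := neg (dia0 (neg φ))
def box1 (φ : BForm) : BForm := neg (dia1 (neg φ))
/-- `□₀⁺φ := φ ∧ □₀φ` -/
def boxP0 (φ : BForm) : BForm := and φ (box0 φ)
/-- `□₁⁺φ := φ ∧ □₁φ` -/
def boxP1 (φ : BForm) : BForm := and φ (box1 φ)

/-- Modal nesting depth. -/
def depth : BForm → ℕ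
  | var _ => 0
  | neg φ => depth φ
  | and φ ψ => max (depth φ) (depth ψ)
  | dia0 φ => depth φ + 1
  | dia1 φ => depth φ + 1

/-- The propositional variable `k` occurs in the formula. -/
def Occurs (k : ℕ) : BForm → Prop
  | var n => k = n
  | neg φ => Occurs k φ
  | and φ ψ => Occurs k φ ∨ Occurs k ψ
  | dia0 φ => Occurs k φ
  | dia1 φ => Occurs k φ

/-- The formula uses only the modal operator `◇₀`. -/
def OnlyDia0 : BForm → Prop
  | var _ => True
  | neg φ => OnlyDia0 φ
  | and φ ψ => OnlyDia0 φ ∧ OnlyDia0 ψ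
  | dia0 φ => OnlyDia0 φ
  | dia1 _ => False

/-- The formula uses only the modal operator `◇₁`. -/
def OnlyDia1 : BForm → Prop
  | var _ => True
  | neg φ => OnlyDia1 φ
  | and φ ψ => OnlyDia1 φ ∧ OnlyDia1 ψ
  | dia0 _ => False
  | dia1 φ => OnlyDia1 φ

/-- Relativisation `φ^D` of each diamond to the variable `d`:
each subformula `◇ᵢψ` is replaced by `◇ᵢ(D ∧ ψ^D)`. -/
def relativize (d : ℕ) : BForm → BForm
  | var n => var n
  | neg φ => neg (relativize d φ)
  | and φ ψ => and (relativize d φ) (relativize d ψ)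
  | dia0 φ => dia0 (and (var d) (relativize d φ))
  | dia1 φ => dia1 (and (var d) (relativize d φ))

/-- `□₀^k φ` -/
def iterBox0 : ℕ → BForm → BForm
  | 0, φ => φ
  | n+1, φ => box0 (iterBox0 n φ)

/-- `□₁^k φ` -/
def iterBox1 : ℕ → BForm → BForm
  | 0, φ => φ
  | n+1, φ => box1 (iterBox1 n φ)

/-- `□₀^{≤n} φ := ⋀_{k ≤ n} □₀^k φ` -/
def boxLe0 : ℕ → BForm → BForm
  | 0, φ => φ
  | n+1, φ => and (boxLe0 n φ) (iterBox0 (n+1) φ)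

/-- `□₁^{≤n} φ := ⋀_{k ≤ n} □₁^k φ` -/
def boxLe1 : ℕ → BForm → BForm
  | 0, φ => φ
  | n+1, φ => and (boxLe1 n φ) (iterBox1 (n+1) φ)

/-- Uniform substitution. -/
def subst (s : ℕ → BForm) : BForm → BForm
  | var n => s n
  | neg φ => neg (subst s φ)
  | and φ ψ => and (subst s φ) (subst s ψ)
  | dia0 φ => dia0 (subst s φ)
  | dia1 φ => dia1 (subst s φ)

end BForm

/-- Kripke truth over a 2-frame `⟨W, R0, R1⟩` with valuation `val`. -/
def BSat {W : Type} (R0 R1 : W → W → Prop) (val : ℕ → W → Prop) : W → BForm → Prop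
  | w, .var n => val n w
  | w, .neg φ => ¬ BSat R0 R1 val w φ
  | w, .and φ ψ => BSat R0 R1 val w φ ∧ BSat R0 R1 val w ψ
  | w, .dia0 φ => ∃ v, R0 w v ∧ BSat R0 R1 val v φ
  | w, .dia1 φ => ∃ v, R1 w v ∧ BSat R0 R1 val v φ

/-! ## Frames -/

/-- A (unimodal) frame: a nonempty set with a binary relation. -/
structure Frame : Type 1 where
  W : Type
  R : W → W → Prop
  ne : Nonempty W

/-- A 2-frame: a nonempty set with two binary relations. -/
structure Frame2 : Type 1 where
  W : Type
  R0 : W → W → Prop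
  R1 : W → W → Prop
  ne : Nonempty W

/-- Validity of a bimodal formula in a 2-frame. -/
def Frame2.Valid (F : Frame2) (φ : BForm) : Prop :=
  ∀ (val : ℕ → F.W → Prop) (w : F.W), BSat F.R0 F.R1 val w φ

/-- Satisfaction of a bimodal formula in some model based on the 2-frame. -/
def Frame2.Sat (F : Frame2) (φ : BForm) : Prop :=
  ∃ (val : ℕ → F.W → Prop) (w : F.W), BSat F.R0 F.R1 val w φ

/-- Horizontal relation of a product frame. -/
def prodR0 {A B : Type} (R : A → A → Prop) : A × B → A × B → Prop :=
  fun p q => R p.1 q.1 ∧ p.2 = q.2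

/-- Vertical relation of a product frame. -/
def prodR1 {A B : Type} (S : B → B → Prop) : A × B → A × B → Prop :=
  fun p q => p.1 = q.1 ∧ S p.2 q.2

/-- `φ` is satisfied in some model based on the product frame `⟨A,R⟩ × ⟨B,S⟩`. -/
def ProdSat {A B : Type} (R : A → A → Prop) (S : B → B → Prop) (φ : BForm) : Prop :=
  ∃ (val : ℕ → A × B → Prop) (w : A × B), BSat (prodR0 R) (prodR1 S) val w φ

/-- `φ` is valid in the product frame `⟨A,R⟩ × ⟨B,S⟩`. -/
def ProdValid {A B : Type} (R : A → A → Prop) (S : B → B → Prop) (φ : BForm) : Prop :=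
  ∀ (val : ℕ → A × B → Prop) (w : A × B), BSat (prodR0 R) (prodR1 S) val w φ

/-- The product 2-frame of two frames. -/
def prodFrame2 (A B : Type) [Nonempty A] [Nonempty B]
    (R : A → A → Prop) (S : B → B → Prop) : Frame2 :=
  ⟨A × B, prodR0 R, prodR1 S, inferInstance⟩

/-- Linear order: irreflexive, transitive and trichotomous. -/
def IsLin {T : Type} (R : T → T → Prop) : Prop :=
  (∀ x, ¬ R x x) ∧ (∀ x y z, R x y → R y z → R x z) ∧ (∀ x y, R x y ∨ x = y ∨ R y x)

/-- Weak order: transitive and weakly connected. -/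
def WeakOrd {T : Type} (R : T → T → Prop) : Prop :=
  (∀ x y z, R x y → R y z → R x z) ∧ (∀ x y z, R x y → R x z → y = z ∨ R y z ∨ R z y)

/-- Modal discreteness. -/
def ModallyDiscrete {T : Type} (R : T → T → Prop) : Prop :=
  ¬ ∃ (x : ℕ → T) (xω : T), (∀ i, R (x i) (x (i+1))) ∧ (∀ i, x i ≠ x (i+1)) ∧
      (∀ i, R (x i) xω) ∧ (∀ i, ¬ R xω (x i))

/-- No infinite ascending chains of distinct points. -/
def Noetherian {T : Type} (R : T → T → Prop) : Prop :=
  ¬ ∃ x : ℕ → T, (∀ i, R (x i) (x (i+1))) ∧ (∀ i, x i ≠ x (i+1))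

/-- The frame is (isomorphic to) `⟨ω,<⟩`. -/
def IsOmegaFrame (F : Frame) : Prop :=
  ∃ e : F.W ≃ ℕ, ∀ a b, F.R a b ↔ e a < e b

/-- The frame is a finite linear order. -/
def IsFinLinFrame (F : Frame) : Prop := Finite F.W ∧ IsLin F.R

/-- `F` contains an `⟨ω+1,>⟩`-type chain: distinct points `x₀,…,x_n,…,x_ω` with
`x_n R x_m` iff `n > m` (for `n ≠ m`). -/
def HasOmegaPlusOneChain (F : Frame) : Prop :=
  ∃ (x : ℕ → F.W) (xω : F.W), Function.Injective x ∧ (∀ n, x n ≠ xω) ∧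
    (∀ n m, n ≠ m → (F.R (x n) (x m) ↔ m < n)) ∧
    (∀ n, F.R xω (x n)) ∧ (∀ n, ¬ F.R (x n) xω)

/-! ## Two-dimensional (expanding/decreasing) 2-frames `H_{F,Ḡ}` -/

/-- A 2-frame `H_{F,Ḡ}` built from a horizontal frame `⟨H,R⟩` and, for each `x : H`,
a vertical frame `G_x = ⟨D x, S x⟩` carved out of a common ambient type `V`. -/
structure TwoFrame : Type 1 where
  H : Type
  R : H → H → Prop
  Hne : Nonempty H
  V : Type
  D : H → Set V
  S : H → V → V → Prop
  Dne : ∀ x, (D x).Nonempty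

namespace TwoFrame

/-- The horizontal frame. -/
def horiz (T : TwoFrame) : Frame := ⟨T.H, T.R, T.Hne⟩

/-- The vertical frame `G_x` at `x`. -/
def fiber (T : TwoFrame) (x : T.H) : Frame :=
  ⟨{a : T.V // a ∈ T.D x}, fun a b => T.S x a.1 b.1,
    Exists.elim (T.Dne x) (fun a ha => ⟨⟨a, ha⟩⟩)⟩

/-- The worlds `{⟨u,v⟩ : u ∈ H, v ∈ D u}`. -/
def Worlds (T : TwoFrame) : Type := {p : T.H × T.V // p.2 ∈ T.D p.1}

/-- Horizontal relation of `H_{F,Ḡ}`. -/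
def Rh (T : TwoFrame) : T.Worlds → T.Worlds → Prop :=
  fun p q => T.R p.1.1 q.1.1 ∧ p.1.2 = q.1.2

/-- Vertical relation of `H_{F,Ḡ}`. -/
def Rv (T : TwoFrame) : T.Worlds → T.Worlds → Prop :=
  fun p q => p.1.1 = q.1.1 ∧ T.S p.1.1 p.1.2 q.1.2

/-- `φ` is satisfied in some model based on `H_{F,Ḡ}`. -/
def Sat (T : TwoFrame) (φ : BForm) : Prop :=
  ∃ (val : ℕ → T.Worlds → Prop) (w : T.Worlds), BSat T.Rh T.Rv val w φ

/-- Decreasing 2-frame: `G_y` is a subframe of `G_x` whenever `x R y`. -/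
def Decreasing (T : TwoFrame) : Prop :=
  ∀ x y, T.R x y → T.D y ⊆ T.D x ∧ ∀ a ∈ T.D y, ∀ b ∈ T.D y, (T.S y a b ↔ T.S x a b)

/-- Expanding 2-frame: `G_x` is a subframe of `G_y` whenever `x R y`. -/
def Expanding (T : TwoFrame) : Prop :=
  ∀ x y, T.R x y → T.D x ⊆ T.D y ∧ ∀ a ∈ T.D x, ∀ b ∈ T.D x, (T.S x a b ↔ T.S y a b)

/-- All vertical frames are difference frames. -/
def DiffFibers (T : TwoFrame) : Prop :=
  ∀ x, ∀ a ∈ T.D x, ∀ b ∈ T.D x, (T.S x a b ↔ a ≠ b)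

end TwoFrame

/-- `φ` is satisfied in some model based on a product of a member of `C`
with a difference frame. -/
def ProdDiffSat (C : Frame → Prop) (φ : BForm) : Prop :=
  ∃ F : Frame, C F ∧ ∃ D : Type, Nonempty D ∧ ProdSat F.R (fun a b : D => a ≠ b) φ

/-- `φ` is satisfied in some model based on a decreasing 2-frame with horizontal
frame in `C` and all vertical frames difference frames. -/
def DecDiffSat (C : Frame → Prop) (φ : BForm) : Prop :=
  ∃ T : TwoFrame, C T.horiz ∧ T.Decreasing ∧ T.DiffFibers ∧ T.Sat φ

/-- `φ` is satisfied in some model based on an expanding 2-frame with horizontal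
frame in `C` and all vertical frames difference frames. -/
def ExpDiffSat (C : Frame → Prop) (φ : BForm) : Prop :=
  ∃ T : TwoFrame, C T.horiz ∧ T.Expanding ∧ T.DiffFibers ∧ T.Sat φ

/-- `φ` is satisfied in some model based on a product of a member of `C0` with a
member of `C1`. -/
def ProdClassSat (C0 C1 : Frame → Prop) (φ : BForm) : Prop :=
  ∃ F0, C0 F0 ∧ ∃ F1, C1 F1 ∧ ProdSat F0.R F1.R φ

/-- `φ` is satisfied in some model based on a decreasing 2-frame with horizontal
frame in `C0` and all vertical frames in `C1`. -/
def DecClassSat (C0 C1 : Frame → Prop) (φ : BForm) : Prop :=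
  ∃ T : TwoFrame, C0 T.horiz ∧ (∀ x, C1 (T.fiber x)) ∧ T.Decreasing ∧ T.Sat φ

/-- `φ` is satisfied in some model based on an expanding 2-frame with horizontal
frame in `C0` and all vertical frames in `C1`. -/
def ExpClassSat (C0 C1 : Frame → Prop) (φ : BForm) : Prop :=
  ∃ T : TwoFrame, C0 T.horiz ∧ (∀ x, C1 (T.fiber x)) ∧ T.Expanding ∧ T.Sat φ

/-- Satisfiability over products of `⟨ω,<⟩` with difference frames. -/
def OmegaDiffSat (φ : BForm) : Prop :=
  ∃ D : Type, Nonempty D ∧ ProdSat (fun m n : ℕ => m < n) (fun a b : D => a ≠ b) φ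

/-- Satisfiability over products of finite linear orders with difference frames. -/
def FinLinDiffSat (φ : BForm) : Prop :=
  ∃ (T : Type) (R : T → T → Prop), Finite T ∧ IsLin R ∧
    ∃ D : Type, Nonempty D ∧ ProdSat R (fun a b : D => a ≠ b) φ

/-! ## Bimodal logics -/

/-- Propositional tautology (diamond formulas treated as atoms). -/
def IsTaut (φ : BForm) : Prop :=
  ∀ v : BForm → Prop, (∀ ψ, v (BForm.neg ψ) ↔ ¬ v ψ) →
    (∀ ψ χ, v (BForm.and ψ χ) ↔ v ψ ∧ v χ) → v φ

/-- Normal bimodal logic. -/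
structure IsLogic (L : Set BForm) : Prop where
  taut : ∀ φ, IsTaut φ → φ ∈ L
  K0 : BForm.imp (BForm.box0 (BForm.imp (BForm.var 0) (BForm.var 1)))
        (BForm.imp (BForm.box0 (BForm.var 0)) (BForm.box0 (BForm.var 1))) ∈ L
  K1 : BForm.imp (BForm.box1 (BForm.imp (BForm.var 0) (BForm.var 1)))
        (BForm.imp (BForm.box1 (BForm.var 0)) (BForm.box1 (BForm.var 1))) ∈ L
  mp : ∀ φ ψ, BForm.imp φ ψ ∈ L → φ ∈ L → ψ ∈ L
  subst : ∀ φ s, φ ∈ L → BForm.subst s φ ∈ L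
  nec0 : ∀ φ, φ ∈ L → BForm.box0 φ ∈ L
  nec1 : ∀ φ, φ ∈ L → BForm.box1 φ ∈ L

/-- Validity of a (◇₀-)formula in a unimodal frame `⟨W,R⟩`. -/
def UValid0 {W : Type} (R : W → W → Prop) (φ : BForm) : Prop :=
  ∀ (val : ℕ → W → Prop) (w : W), BSat R (fun _ _ => False) val w φ

/-- Validity of a (◇₁-)formula in a unimodal frame `⟨W,S⟩`. -/
def UValid1 {W : Type} (S : W → W → Prop) (φ : BForm) : Prop :=
  ∀ (val : ℕ → W → Prop) (w : W), BSat (fun _ _ => False) S val w φ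

/-- `K4.3`: the unimodal logic (in `◇₀`) of all linear orders. -/
def K43 : Set BForm :=
  {φ | φ.OnlyDia0 ∧ ∀ (T : Type) (R : T → T → Prop), Nonempty T → IsLin R → UValid0 R φ}

/-- `Diff`: the unimodal logic (in `◇₁`) of all difference frames. -/
def DiffLogic : Set BForm :=
  {φ | φ.OnlyDia1 ∧ ∀ (D : Type), Nonempty D → UValid1 (fun a b : D => a ≠ b) φ}

/-- `Log⟨ω,<⟩`: the unimodal logic (in `◇₀`) of the frame `⟨ω,<⟩`. -/
def LogOmega : Set BForm :=
  {φ | φ.OnlyDia0 ∧ UValid0 (fun m n : ℕ => m < n) φ}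

/-- `GL.3`: the unimodal logic (in `◇₀`) of all Noetherian irreflexive linear orders. -/
def GL3 : Set BForm :=
  {φ | φ.OnlyDia0 ∧
    ∀ (T : Type) (R : T → T → Prop), Nonempty T → IsLin R → Noetherian R → UValid0 R φ}

/-- `DisK4.3`: the unimodal logic (in `◇₀`) of all modally discrete weak orders. -/
def DisK43 : Set BForm :=
  {φ | φ.OnlyDia0 ∧
    ∀ (T : Type) (R : T → T → Prop), Nonempty T → WeakOrd R → ModallyDiscrete R → UValid0 R φ}

def commAx1 : BForm :=
  BForm.imp (BForm.box1 (BForm.box0 (BForm.var 0))) (BForm.box0 (BForm.box1 (BForm.var 0)))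
def commAx2 : BForm :=
  BForm.imp (BForm.box0 (BForm.box1 (BForm.var 0))) (BForm.box1 (BForm.box0 (BForm.var 0)))
def commAx3 : BForm :=
  BForm.imp (BForm.dia0 (BForm.box1 (BForm.var 0))) (BForm.box1 (BForm.dia0 (BForm.var 0)))

/-- The commutator `[L0,L1]`: the smallest bimodal logic containing `L0`, `L1` (and
hence their fusion) together with the commutativity/confluence axioms. -/
def Commutator (L0 L1 : Set BForm) : Set BForm :=
  ⋂₀ {L : Set BForm | IsLogic L ∧ L0 ⊆ L ∧ L1 ⊆ L ∧
      commAx1 ∈ L ∧ commAx2 ∈ L ∧ commAx3 ∈ L}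

/-- The product logic `L0 × L1`: the logic of all products of a frame for `L0`
with a frame for `L1`. -/
def ProdLogic (L0 L1 : Set BForm) : Set BForm :=
  {φ | ∀ (A B : Type), Nonempty A → Nonempty B → ∀ (R : A → A → Prop) (S : B → B → Prop),
      (∀ ψ ∈ L0, UValid0 R ψ) → (∀ ψ ∈ L1, UValid1 S ψ) → ProdValid R S φ}

/-- The logic of a class of 2-frames. -/
def LogOf (C : Frame2 → Prop) : Set BForm := {φ | ∀ F, C F → F.Valid φ}

/-- Kripke completeness of a bimodal logic. -/
def KripkeComplete (L : Set BForm) : Prop := ∃ C : Frame2 → Prop, L = LogOf C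

/-- `L`-satisfiability: `φ` is satisfied in some model `M` with `M ⊨ L`. -/
def LSat (L : Set BForm) (φ : BForm) : Prop :=
  ∃ (W : Type) (_ : Nonempty W) (R0 R1 : W → W → Prop) (val : ℕ → W → Prop),
    (∀ ψ ∈ L, ∀ w, BSat R0 R1 val w ψ) ∧ ∃ w, BSat R0 R1 val w φ

/-! ## One-variable first-order temporal logic with counting (FOLTL≠) -/

/-- FOLTL≠-formulas: `φ ::= P(x) | ¬φ | φ∧ψ | ◇_F φ | ∃≠x φ`. -/
inductive TForm : Type
  | atom : ℕ → TForm
  | neg : TForm → TForm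
  | and : TForm → TForm → TForm
  | diaF : TForm → TForm
  | exNe : TForm → TForm

/-- Truth of an FOLTL≠-formula in a first-order temporal model based on the
timeline `⟨T,lt⟩` with domains `D` and interpretation `I`. -/
def TSat {T U : Type} (lt : T → T → Prop) (D : T → Set U) (I : ℕ → T → U → Prop) :
    T → U → TForm → Prop
  | t, a, .atom n => I n t a
  | t, a, .neg φ => ¬ TSat lt D I t a φ
  | t, a, .and φ ψ => TSat lt D I t a φ ∧ TSat lt D I t a ψ
  | t, a, .diaF φ => ∃ t', lt t t' ∧ a ∈ D t' ∧ TSat lt D I t' a φ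
  | t, a, .exNe φ => ∃ b, b ∈ D t ∧ b ≠ a ∧ TSat lt D I t b φ

/-- The standard translation `⋆` from FOLTL≠-formulas to bimodal formulas. -/
def TForm.star : TForm → BForm
  | .atom n => .var n
  | .neg φ => .neg (TForm.star φ)
  | .and φ ψ => .and (TForm.star φ) (TForm.star ψ)
  | .diaF φ => .dia0 (TForm.star φ)
  | .exNe φ => .dia1 (TForm.star φ)

/-- Satisfiability in constant domain models over the timeline `⟨T,lt⟩`. -/
def FOLTLConstSat {T : Type} (lt : T → T → Prop) (φ : TForm) : Prop :=
  ∃ (U : Type) (I : ℕ → T → U → Prop) (t : T) (a : U),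
    TSat lt (fun _ => (Set.univ : Set U)) I t a φ

/-- Satisfiability in decreasing domain models over the timeline `⟨T,lt⟩`. -/
def FOLTLDecSat {T : Type} (lt : T → T → Prop) (φ : TForm) : Prop :=
  ∃ (U : Type) (D : T → Set U), (∀ t, (D t).Nonempty) ∧
    (∀ t t', lt t t' → D t' ⊆ D t) ∧
    ∃ (I : ℕ → T → U → Prop) (t : T) (a : U), a ∈ D t ∧ TSat lt D I t a φ

/-- Satisfiability in expanding domain models over the timeline `⟨T,lt⟩`. -/
def FOLTLExpSat {T : Type} (lt : T → T → Prop) (φ : TForm) : Prop :=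
  ∃ (U : Type) (D : T → Set U), (∀ t, (D t).Nonempty) ∧
    (∀ t t', lt t t' → D t ⊆ D t') ∧
    ∃ (I : ℕ → T → U → Prop) (t : T) (a : U), a ∈ D t ∧ TSat lt D I t a φ

/-- Satisfiability in constant domain models over a class `C` of timelines. -/
def FOLTLConstSatC (C : Frame → Prop) (φ : TForm) : Prop :=
  ∃ F, C F ∧ FOLTLConstSat F.R φ

/-- Satisfiability in decreasing domain models over a class `C` of timelines. -/
def FOLTLDecSatC (C : Frame → Prop) (φ : TForm) : Prop :=
  ∃ F, C F ∧ FOLTLDecSat F.R φ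

/-- Satisfiability in expanding domain models over a class `C` of timelines. -/
def FOLTLExpSatC (C : Frame → Prop) (φ : TForm) : Prop :=
  ∃ F, C F ∧ FOLTLExpSat F.R φ

/-- The class of all linear orders. -/
def AllLin : Frame → Prop := fun F => IsLin F.R

/-- The class of all finite linear orders. -/
def AllFinLin : Frame → Prop := IsFinLinFrame

/-! ## Gödel numbering -/

/-- A fixed effective Gödel numbering of bimodal formulas. -/
def encodeB : BForm → ℕ
  | .var n => Nat.pair 0 n
  | .neg φ => Nat.pair 1 (encodeB φ)
  | .and φ ψ => Nat.pair 2 (Nat.pair (encodeB φ) (encodeB ψ))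
  | .dia0 φ => Nat.pair 3 (encodeB φ)
  | .dia1 φ => Nat.pair 4 (encodeB φ)

/-- A fixed effective Gödel numbering of FOLTL≠-formulas. -/
def encodeT : TForm → ℕ
  | .atom n => Nat.pair 0 n
  | .neg φ => Nat.pair 1 (encodeT φ)
  | .and φ ψ => Nat.pair 2 (Nat.pair (encodeT φ) (encodeT ψ))
  | .diaF φ => Nat.pair 3 (encodeT φ)
  | .exNe φ => Nat.pair 4 (encodeT φ)

/-- The set of codes of bimodal formulas with property `P`. -/
def BCodes (P : BForm → Prop) : ℕ → Prop := fun n => ∃ φ, encodeB φ = n ∧ P φ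

/-- The set of codes of FOLTL≠-formulas with property `P`. -/
def TCodes (P : TForm → Prop) : ℕ → Prop := fun n => ∃ φ, encodeT φ = n ∧ P φ

/-! ## The analytical hierarchy: Σ₁¹ -/

/-- `A ⊆ ℕ` is `Σ₁¹`: in normal form `n ∈ A ↔ ∃ f : ℕ → ℕ, ∀ m, R (n, f̄(m))`
for a computable predicate `R` of the number `n` and finite initial segments of `f`. -/
def Sigma11 (A : ℕ → Prop) : Prop :=
  ∃ R : ℕ × List ℕ → Prop, ComputablePred R ∧
    ∀ n, A n ↔ ∃ f : ℕ → ℕ, ∀ m, R (n, (List.range m).map f)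

/-- `Σ₁¹`-hardness with respect to computable many-one reducibility. -/
def Sigma11Hard (A : ℕ → Prop) : Prop := ∀ B : ℕ → Prop, Sigma11 B → ManyOneReducible B A

/-- `Σ₁¹`-completeness. -/
def Sigma11Complete (A : ℕ → Prop) : Prop := Sigma11 A ∧ Sigma11Hard A

/-! ## Counter (Minsky) machines -/

/-- Counter machine operations: `inl i` increments counter `i`, `inr (inl i)`
decrements counter `i`, `inr (inr i)` zero-tests counter `i`. -/
abbrev CMOp : Type := ℕ ⊕ ℕ ⊕ ℕ

def CMOp.counter : CMOp → ℕ
  | Sum.inl i => i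
  | Sum.inr (Sum.inl i) => i
  | Sum.inr (Sum.inr i) => i

/-- Description of a counter machine: number `N` of counters, number of states
(states are `0,…,states-1`), list of terminal states, and list of instructions
`(q, op, q')`. -/
abbrev CMDesc : Type := ℕ × ℕ × List ℕ × List (ℕ × CMOp × ℕ)

/-- Well-formedness of a counter machine description: `N > 1`, terminal states are
states, instructions are attached to non-terminal states and mention genuine
counters, and every non-terminal state has at least one instruction. -/
def CMWF (M : CMDesc) : Prop :=
  1 < M.1 ∧ (∀ q ∈ M.2.2.1, q < M.2.1) ∧
  (∀ t ∈ M.2.2.2, t.1 < M.2.1 ∧ t.1 ∉ M.2.2.1 ∧ t.2.2 < M.2.1 ∧ CMOp.counter t.2.1 < M.1) ∧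
  (∀ q, q < M.2.1 → q ∉ M.2.2.1 → ∃ t ∈ M.2.2.2, t.1 = q)

/-- A configuration: current state and contents of the counters. -/
abbrev CMConfig : Type := ℕ × (ℕ → ℕ)

/-- Reliable step of a counter machine. -/
def CMStep (M : CMDesc) (σ σ' : CMConfig) : Prop :=
  ∃ op q', (σ.1, op, q') ∈ M.2.2.2 ∧ σ'.1 = q' ∧
    match op with
    | Sum.inl i => σ'.2 i = σ.2 i + 1 ∧ ∀ j, j ≠ i → σ'.2 j = σ.2 j
    | Sum.inr (Sum.inl i) => 0 < σ.2 i ∧ σ'.2 i + 1 = σ.2 i ∧ ∀ j, j ≠ i → σ'.2 j = σ.2 j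
    | Sum.inr (Sum.inr i) => σ.2 i = 0 ∧ ∀ j, σ'.2 j = σ.2 j

/-- Lossy step of a counter machine. -/
def CMStepLossy (M : CMDesc) (σ σ' : CMConfig) : Prop :=
  ∃ c1 c2 : ℕ → ℕ, CMStep M (σ.1, c1) (σ'.1, c2) ∧ (∀ i, c1 i ≤ σ.2 i) ∧ (∀ i, σ'.2 i ≤ c2 i)

/-- The configuration `⟨q, 𝟎⟩` with all-0 counters. -/
def zeroConfig (q : ℕ) : CMConfig := (q, fun _ => 0)

/-- CM non-termination: the machine has an infinite run starting with `⟨q₀,𝟎⟩`. -/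
def CMNonTerm : CMDesc × ℕ → Prop := fun p =>
  CMWF p.1 ∧ ∃ ρ : ℕ → CMConfig, ρ 0 = zeroConfig p.2 ∧ ∀ n, CMStep p.1 (ρ n) (ρ (n+1))

/-- CM reachability: the machine has a run starting with `⟨q₀,𝟎⟩` reaching `q_r`. -/
def CMReach : CMDesc × ℕ × ℕ → Prop := fun p =>
  CMWF p.1 ∧ ∃ (B : ℕ) (ρ : ℕ → CMConfig), ρ 0 = zeroConfig p.2.1 ∧
    (∀ n, n < B → CMStep p.1 (ρ n) (ρ (n+1))) ∧ (ρ B).1 = p.2.2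

/-- CM recurrence: the machine has an infinite run starting with `⟨q₀,𝟎⟩`
visiting `q_r` infinitely often. -/
def CMRecur : CMDesc × ℕ × ℕ → Prop := fun p =>
  CMWF p.1 ∧ ∃ ρ : ℕ → CMConfig, ρ 0 = zeroConfig p.2.1 ∧
    (∀ n, CMStep p.1 (ρ n) (ρ (n+1))) ∧ ∀ n, ∃ m, n ≤ m ∧ (ρ m).1 = p.2.2

/-- LCM reachability: the machine has a lossy run starting with `⟨q₀,𝟎⟩`
reaching `q_r`. -/
def LCMReach : CMDesc × ℕ × ℕ → Prop := fun p =>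
  CMWF p.1 ∧ ∃ (B : ℕ) (ρ : ℕ → CMConfig), ρ 0 = zeroConfig p.2.1 ∧
    (∀ n, n < B → CMStepLossy p.1 (ρ n) (ρ (n+1))) ∧ (ρ B).1 = p.2.2

/-- LCM ω-reachability: for every `k`, the machine has a lossy run starting with
`⟨q₀,𝟎⟩` visiting `q_r` at least `k` times. -/
def LCMOmegaReach : CMDesc × ℕ × ℕ → Prop := fun p =>
  CMWF p.1 ∧ ∀ k : ℕ, ∃ (B : ℕ) (ρ : ℕ → CMConfig), ρ 0 = zeroConfig p.2.1 ∧
    (∀ n, n < B → CMStepLossy p.1 (ρ n) (ρ (n+1))) ∧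
    k ≤ ((Finset.range (B+1)).filter (fun n => (ρ n).1 = p.2.2)).card

/-! ## Particular formulas used in the statements -/

/-- `□₁⁺□₀⁺(◇₀⊤ → □₁◇₀⊤) ∧ φ` (Prop. 2.4 of the paper). -/
def diffDecForm (φ : BForm) : BForm :=
  BForm.and
    (BForm.boxP1 (BForm.boxP0
      (BForm.imp (BForm.dia0 BForm.top) (BForm.box1 (BForm.dia0 BForm.top))))) φ

/-- `D ∧ □₀^{≤n}□₁^{≤n}(◇₀D → D) ∧ φ^D`. -/
def decRelForm (d n : ℕ) (φ : BForm) : BForm :=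
  BForm.and (BForm.var d)
    (BForm.and
      (BForm.boxLe0 n (BForm.boxLe1 n
        (BForm.imp (BForm.dia0 (BForm.var d)) (BForm.var d))))
      (BForm.relativize d φ))

/-- `D ∧ □₀^{≤n}□₁^{≤n}(D → □₀D) ∧ φ^D`. -/
def expRelForm (d n : ℕ) (φ : BForm) : BForm :=
  BForm.and (BForm.var d)
    (BForm.and
      (BForm.boxLe0 n (BForm.boxLe1 n
        (BForm.imp (BForm.var d) (BForm.box0 (BForm.var d)))))
      (BForm.relativize d φ))

section PartC

/-! ## Truth conditions of the abbreviations -/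

section SatLemmas
variable {W : Type} {R0 R1 : W → W → Prop} {val : ℕ → W → Prop} {w : W} {φ ψ : BForm}

theorem sat_neg : BSat R0 R1 val w (.neg φ) ↔ ¬ BSat R0 R1 val w φ := Iff.rfl

theorem sat_and : BSat R0 R1 val w (.and φ ψ) ↔ BSat R0 R1 val w φ ∧ BSat R0 R1 val w ψ := Iff.rfl

theorem sat_var {n : ℕ} : BSat R0 R1 val w (.var n) ↔ val n w := Iff.rfl

theorem sat_dia0 : BSat R0 R1 val w (.dia0 φ) ↔ ∃ v, R0 w v ∧ BSat R0 R1 val v φ := Iff.rfl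

theorem sat_dia1 : BSat R0 R1 val w (.dia1 φ) ↔ ∃ v, R1 w v ∧ BSat R0 R1 val v φ := Iff.rfl

theorem sat_imp : BSat R0 R1 val w (.imp φ ψ) ↔ (BSat R0 R1 val w φ → BSat R0 R1 val w ψ) := by
  simp only [BForm.imp, sat_neg, sat_and]
  tauto

theorem sat_bot : BSat R0 R1 val w .bot ↔ False := by
  simp [BForm.bot, sat_neg, sat_and]

theorem sat_top : BSat R0 R1 val w .top ↔ True := by
  simp [BForm.top, sat_neg, sat_bot]

theorem sat_box0 : BSat R0 R1 val w (.box0 φ) ↔ ∀ v, R0 w v → BSat R0 R1 val v φ := by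
  simp [BForm.box0, sat_neg, sat_dia0]

theorem sat_box1 : BSat R0 R1 val w (.box1 φ) ↔ ∀ v, R1 w v → BSat R0 R1 val v φ := by
  simp [BForm.box1, sat_neg, sat_dia1]

theorem sat_boxP1 : BSat R0 R1 val w (.boxP1 φ) ↔
    ∀ v, w = v ∨ R1 w v → BSat R0 R1 val v φ := by
  simp only [BForm.boxP1, sat_and, sat_box1]
  constructor
  · rintro ⟨h1, h2⟩ v (rfl | hv)
    · exact h1
    · exact h2 v hv
  · intro h
    exact ⟨h w (Or.inl rfl), fun v hv => h v (Or.inr hv)⟩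

theorem subst_imp (s : ℕ → BForm) : (BForm.imp φ ψ).subst s = .imp (φ.subst s) (ψ.subst s) := rfl

end SatLemmas

/-! ## Passing to a canonical (ultrafilter) model -/

/-- The frame conditions corresponding to the axioms of `[K4.3,Diff]` that we use. -/
structure GoodFrame {W : Type} (R0 R1 : W → W → Prop) : Prop where
  trans : ∀ x y z, R0 x y → R0 y z → R0 x z
  wcon : ∀ x y z, R0 x y → R0 x z → y = z ∨ R0 y z ∨ R0 z y
  symm : ∀ x y, R1 x y → R1 y x
  ptrans : ∀ x y z, R1 x y → R1 y z → x = z ∨ R1 x z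
  comm : ∀ x y z, R0 x y → R1 y z → ∃ w, R1 x w ∧ R0 w z
  comm' : ∀ x y z, R1 x y → R0 y z → ∃ w, R0 x w ∧ R1 w z

/-- The filter of those sets `A` such that `u`-almost all points have all `R`-successors in `A`. -/
def boxFilter {W : Type} (R : W → W → Prop) (u : Filter W) : Filter W where
  sets := {A | ∀ᶠ w in u, ∀ v, R w v → v ∈ A}
  univ_sets := by simp
  sets_of_superset := by
    intro A B hA hAB
    exact Filter.Eventually.mono hA (fun w hw v hv => hAB (hw v hv))
  inter_sets := by
    intro A B hA hB
    exact (Filter.Eventually.and hA hB).mono (fun w hw v hv => ⟨hw.1 v hv, hw.2 v hv⟩)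

section Canon
variable {W : Type} (R0 R1 : W → W → Prop) (val : ℕ → W → Prop)

/-- The theory of an ultrafilter. -/
def thy (u : Ultrafilter W) : Set BForm := {ψ | ∀ᶠ w in (u : Filter W), BSat R0 R1 val w ψ}

/-- Worlds of the canonical model. -/
def CanonW : Type := {Γ : Set BForm // ∃ u : Ultrafilter W, thy R0 R1 val u = Γ}

/-- Canonical relation for a diamond. -/
def canonR (D : BForm → BForm) (Γ Δ : CanonW R0 R1 val) : Prop := ∀ ψ ∈ Δ.1, D ψ ∈ Γ.1

variable {R0 R1 val}

theorem thy_neg (u : Ultrafilter W) (ψ : BForm) :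
    BForm.neg ψ ∈ thy R0 R1 val u ↔ ψ ∉ thy R0 R1 val u := by
  simp only [thy, Set.mem_ofPred_eq, BSat]
  exact Ultrafilter.eventually_not

theorem thy_and (u : Ultrafilter W) (ψ χ : BForm) :
    BForm.and ψ χ ∈ thy R0 R1 val u ↔ ψ ∈ thy R0 R1 val u ∧ χ ∈ thy R0 R1 val u := by
  simp only [thy, Set.mem_ofPred_eq, BSat]
  exact Filter.eventually_and

theorem canon_neg (Γ : CanonW R0 R1 val) (ψ : BForm) : BForm.neg ψ ∈ Γ.1 ↔ ψ ∉ Γ.1 := by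
  obtain ⟨_, u, rfl⟩ := Γ
  exact thy_neg u ψ

theorem canon_and (Γ : CanonW R0 R1 val) (ψ χ : BForm) :
    BForm.and ψ χ ∈ Γ.1 ↔ ψ ∈ Γ.1 ∧ χ ∈ Γ.1 := by
  obtain ⟨_, u, rfl⟩ := Γ
  exact thy_and u ψ χ

theorem canon_mono (Γ : CanonW R0 R1 val) {ψ χ : BForm}
    (h : ∀ w, BSat R0 R1 val w ψ → BSat R0 R1 val w χ) (hψ : ψ ∈ Γ.1) : χ ∈ Γ.1 := by
  obtain ⟨_, u, rfl⟩ := Γ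
  exact Filter.Eventually.mono hψ h

theorem canon_false (Γ : CanonW R0 R1 val) {ψ : BForm}
    (h : ∀ w, ¬ BSat R0 R1 val w ψ) (hψ : ψ ∈ Γ.1) : False := by
  have h1 : BForm.neg ψ ∈ Γ.1 := canon_mono Γ (fun w hw => absurd hw (h w)) hψ
  exact (canon_neg Γ ψ).1 h1 hψ

theorem canon_dia (D : BForm → BForm) (R : W → W → Prop)
    (hD : ∀ w ψ, BSat R0 R1 val w (D ψ) ↔ ∃ v, R w v ∧ BSat R0 R1 val v ψ)
    (Γ : CanonW R0 R1 val) (ψ : BForm) :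
    D ψ ∈ Γ.1 ↔ ∃ Δ, canonR R0 R1 val D Γ Δ ∧ ψ ∈ Δ.1 := by
  constructor
  · obtain ⟨_, u, rfl⟩ := Γ
    intro h
    have hne : (boxFilter R (u : Filter W) ⊓ Filter.principal {w | BSat R0 R1 val w ψ}).NeBot := by
      rw [Filter.inf_principal_neBot_iff]
      intro A hA
      have h1 : ∀ᶠ w in (u : Filter W), ∀ v, R w v → v ∈ A := hA
      have h2 : ∀ᶠ w in (u : Filter W), BSat R0 R1 val w (D ψ) := h
      obtain ⟨w, hw1, hw2⟩ := (h1.and h2).exists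
      obtain ⟨v, hv, hv2⟩ := (hD w ψ).1 hw2
      exact ⟨v, hw1 v hv, hv2⟩
    have hle := @Ultrafilter.of_le _ _ hne
    refine ⟨⟨_, @Ultrafilter.of _ _ hne, rfl⟩, ?_, ?_⟩
    · intro χ hχ
      by_contra hc
      have h3 : ∀ᶠ w in (u : Filter W), ¬ BSat R0 R1 val w (D χ) :=
        Ultrafilter.eventually_not.2 hc
      have h4 : {v | ¬ BSat R0 R1 val v χ} ∈ boxFilter R (u : Filter W) := by
        refine h3.mono (fun w hw v hv hv2 => hw ((hD w χ).2 ⟨v, hv, hv2⟩))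
      have h5 := (le_trans hle inf_le_left) h4
      exact Ultrafilter.eventually_not.1 h5 hχ
    · exact (le_trans hle inf_le_right) (Filter.mem_principal_self _)
  · rintro ⟨Δ, h1, h2⟩
    exact h1 ψ h2

theorem canon_truth (Γ : CanonW R0 R1 val) (ψ : BForm) :
    BSat (canonR R0 R1 val BForm.dia0) (canonR R0 R1 val BForm.dia1)
      (fun n Δ => BForm.var n ∈ Δ.1) Γ ψ ↔ ψ ∈ Γ.1 := by
  induction ψ generalizing Γ with
  | var n => exact Iff.rfl
  | neg ψ ih => rw [canon_neg, ← ih]; rfl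
  | and ψ χ ih1 ih2 => rw [canon_and, ← ih1, ← ih2]; rfl
  | dia0 ψ ih =>
    rw [canon_dia BForm.dia0 R0 (fun _ _ => Iff.rfl)]
    simp only [BSat, ih]
  | dia1 ψ ih =>
    rw [canon_dia BForm.dia1 R1 (fun _ _ => Iff.rfl)]
    simp only [BSat, ih]

/-- Canonicity of the commutation axioms. -/
theorem canon_comm (D E : BForm → BForm) (R Q : W → W → Prop)
    (hD : ∀ w ψ, BSat R0 R1 val w (D ψ) ↔ ∃ v, R w v ∧ BSat R0 R1 val v ψ)
    (hE : ∀ w ψ, BSat R0 R1 val w (E ψ) ↔ ∃ v, Q w v ∧ BSat R0 R1 val v ψ)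
    (hax : ∀ w ψ, BSat R0 R1 val w (D (E ψ)) → BSat R0 R1 val w (E (D ψ)))
    (x y z : CanonW R0 R1 val) (hxy : canonR R0 R1 val D x y) (hyz : canonR R0 R1 val E y z) :
    ∃ w, canonR R0 R1 val E x w ∧ canonR R0 R1 val D w z := by
  obtain ⟨_, u, rfl⟩ := x
  let G : Filter W :=
    { sets := {A | ∃ ψ ∈ z.1, ∀ w, BSat R0 R1 val w (D ψ) → w ∈ A}
      univ_sets := by
        obtain ⟨_, v, rfl⟩ := z
        refine ⟨BForm.top, ?_, fun _ _ => trivial⟩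
        refine Filter.Eventually.of_forall (fun w => ?_)
        simp [BForm.top, BForm.bot, BSat]
      sets_of_superset := by
        rintro A B ⟨ψ, h1, h2⟩ hAB
        exact ⟨ψ, h1, fun w hw => hAB (h2 w hw)⟩
      inter_sets := by
        rintro A B ⟨ψ, h1, h2⟩ ⟨χ, h3, h4⟩
        refine ⟨BForm.and ψ χ, (canon_and z ψ χ).2 ⟨h1, h3⟩, fun w hw => ?_⟩
        obtain ⟨v, hv, hv1, hv2⟩ := (hD w _).1 hw
        exact ⟨h2 w ((hD w _).2 ⟨v, hv, hv1⟩), h4 w ((hD w _).2 ⟨v, hv, hv2⟩)⟩ }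
  have hne : (boxFilter Q (u : Filter W) ⊓ G).NeBot := by
    rw [Filter.inf_neBot_iff]
    rintro A hA B ⟨ψ, h1, h2⟩
    have h3 : ∀ᶠ w in (u : Filter W), ∀ v, Q w v → v ∈ A := hA
    have h4 : ∀ᶠ w in (u : Filter W), BSat R0 R1 val w (D (E ψ)) := hxy _ (hyz _ h1)
    obtain ⟨w, hw1, hw2⟩ := (h3.and h4).exists
    obtain ⟨v, hv, hv2⟩ := (hE w _).1 (hax w ψ hw2)
    exact ⟨v, hw1 v hv, h2 v hv2⟩
  have hle := @Ultrafilter.of_le _ _ hne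
  refine ⟨⟨_, @Ultrafilter.of _ _ hne, rfl⟩, ?_, ?_⟩
  · intro χ hχ
    by_contra hc
    have h3 : ∀ᶠ w in (u : Filter W), ¬ BSat R0 R1 val w (E χ) :=
      Ultrafilter.eventually_not.2 hc
    have h4 : {v | ¬ BSat R0 R1 val v χ} ∈ boxFilter Q (u : Filter W) := by
      refine h3.mono (fun w hw v hv hv2 => hw ((hE w χ).2 ⟨v, hv, hv2⟩))
    have h5 := (le_trans hle inf_le_left) h4
    exact Ultrafilter.eventually_not.1 h5 hχ
  · intro ψ hψ
    have h4 : {w | BSat R0 R1 val w (D ψ)} ∈ G := ⟨ψ, hψ, fun w hw => hw⟩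
    exact (le_trans hle inf_le_right) h4

theorem canon_good
    (h4 : ∀ w ψ, BSat R0 R1 val w (.dia0 (.dia0 ψ)) → BSat R0 R1 val w (.dia0 ψ))
    (h3 : ∀ w ψ χ, BSat R0 R1 val w (.dia0 ψ) → BSat R0 R1 val w (.dia0 χ) →
      BSat R0 R1 val w (.dia0 (.and ψ χ)) ∨ BSat R0 R1 val w (.dia0 (.and ψ (.dia0 χ))) ∨
      BSat R0 R1 val w (.dia0 (.and χ (.dia0 ψ))))
    (hB : ∀ w ψ, BSat R0 R1 val w ψ → BSat R0 R1 val w (.neg (.dia1 (.neg (.dia1 ψ)))))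
    (hp : ∀ w ψ, BSat R0 R1 val w (.dia1 (.dia1 ψ)) →
      BSat R0 R1 val w ψ ∨ BSat R0 R1 val w (.dia1 ψ))
    (hc : ∀ w ψ, BSat R0 R1 val w (.dia0 (.dia1 ψ)) → BSat R0 R1 val w (.dia1 (.dia0 ψ)))
    (hc' : ∀ w ψ, BSat R0 R1 val w (.dia1 (.dia0 ψ)) → BSat R0 R1 val w (.dia0 (.dia1 ψ))) :
    GoodFrame (canonR R0 R1 val BForm.dia0) (canonR R0 R1 val BForm.dia1) where
  trans := fun x y z hxy hyz ψ hψ => canon_mono x (fun w => h4 w ψ) (hxy _ (hyz _ hψ))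
  wcon := by
    intro x y z hxy hxz
    by_contra hcon
    push Not at hcon
    obtain ⟨hne, hyz, hzy⟩ := hcon
    have hα : ∃ α, α ∈ y.1 ∧ α ∉ z.1 := by
      by_contra hcon
      push Not at hcon
      apply hne
      apply Subtype.ext
      ext ψ
      refine ⟨hcon ψ, fun h => ?_⟩
      by_contra h1
      have := hcon _ ((canon_neg y ψ).2 h1)
      exact (canon_neg z ψ).1 this h
    obtain ⟨α, hα1, hα2⟩ := hα
    have hβ : ∃ β, β ∈ z.1 ∧ BForm.dia0 β ∉ y.1 := by
      simpa [canonR] using hyz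
    have hγ : ∃ γ, γ ∈ y.1 ∧ BForm.dia0 γ ∉ z.1 := by
      simpa [canonR] using hzy
    obtain ⟨β, hβ1, hβ2⟩ := hβ
    obtain ⟨γ, hγ1, hγ2⟩ := hγ
    have hp1 : BForm.and α (.and γ (.neg (.dia0 β))) ∈ y.1 := by
      simp only [canon_and, canon_neg]; exact ⟨hα1, hγ1, hβ2⟩
    have hq1 : BForm.and (.neg α) (.and β (.neg (.dia0 γ))) ∈ z.1 := by
      simp only [canon_and, canon_neg]; exact ⟨hα2, hβ1, hγ2⟩
    have h1 := hxy _ hp1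
    have h2 := hxz _ hq1
    refine canon_false x ?_ ((canon_and x _ _).2 ⟨h1, h2⟩)
    rintro w ⟨hw1, hw2⟩
    rcases h3 w _ _ hw1 hw2 with h | h | h
    · obtain ⟨v, _, hv⟩ := h
      exact hv.2.1 hv.1.1
    · obtain ⟨v, _, hv, v', hv', hv''⟩ := h
      exact hv.2.2 ⟨v', hv', hv''.2.1⟩
    · obtain ⟨v, _, hv, v', hv', hv''⟩ := h
      exact hv.2.2 ⟨v', hv', hv''.2.1⟩
  symm := by
    intro x y hxy ψ hψ
    by_contra h
    have h1 := hxy _ ((canon_neg y _).2 h)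
    have h2 := canon_mono x (fun w => hB w ψ) hψ
    exact (canon_neg x _).1 h2 h1
  ptrans := by
    intro x y z hxy hyz
    by_contra hcon
    push Not at hcon
    obtain ⟨hne, hxz⟩ := hcon
    have hα : ∃ α, α ∈ z.1 ∧ α ∉ x.1 := by
      by_contra hcon
      push Not at hcon
      apply hne
      apply Subtype.ext
      ext ψ
      refine ⟨fun h => ?_, hcon ψ⟩
      by_contra h1
      have := hcon _ ((canon_neg z ψ).2 h1)
      exact (canon_neg x ψ).1 this h
    obtain ⟨α, hα1, hα2⟩ := hα
    have hβ : ∃ β, β ∈ z.1 ∧ BForm.dia1 β ∉ x.1 := by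
      simpa [canonR] using hxz
    obtain ⟨β, hβ1, hβ2⟩ := hβ
    have h1 := hxy _ (hyz _ ((canon_and z _ _).2 ⟨hα1, hβ1⟩))
    have h2 : BForm.and (.dia1 (.dia1 (.and α β))) (.and (.neg α) (.neg (.dia1 β))) ∈ x.1 := by
      simp only [canon_and, canon_neg]; exact ⟨h1, hα2, hβ2⟩
    refine canon_false x ?_ h2
    rintro w ⟨hw1, hw2, hw3⟩
    rcases hp w _ hw1 with h | ⟨v, hv, h⟩
    · exact hw2 h.1
    · exact hw3 ⟨v, hv, h.2⟩
  comm := canon_comm BForm.dia0 BForm.dia1 R0 R1 (fun _ _ => Iff.rfl) (fun _ _ => Iff.rfl) hc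
  comm' := canon_comm BForm.dia1 BForm.dia0 R1 R0 (fun _ _ => Iff.rfl) (fun _ _ => Iff.rfl) hc'

end Canon

theorem goodModel_of_LSat {L : Set BForm} (hlog : IsLogic L)
    (hcomm : Commutator K43 DiffLogic ⊆ L) {φ : BForm} (h : LSat L φ) :
    ∃ (W : Type) (R0 R1 : W → W → Prop) (val : ℕ → W → Prop) (r : W),
      GoodFrame R0 R1 ∧ BSat R0 R1 val r φ := by
  obtain ⟨W, _, R0, R1, val, hL, w, hw⟩ := h
  have hK : ∀ ψ ∈ K43, ∀ s w, BSat R0 R1 val w (ψ.subst s) := fun ψ hψ s w =>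
    hL _ (hlog.subst ψ s (hcomm (fun L' hL' => hL'.2.1 hψ))) w
  have hDf : ∀ ψ ∈ DiffLogic, ∀ s w, BSat R0 R1 val w (ψ.subst s) := fun ψ hψ s w =>
    hL _ (hlog.subst ψ s (hcomm (fun L' hL' => hL'.2.2.1 hψ))) w
  have hc1 : ∀ s w, BSat R0 R1 val w (commAx1.subst s) := fun s w =>
    hL _ (hlog.subst _ s (hcomm (fun L' hL' => hL'.2.2.2.1))) w
  have hc2 : ∀ s w, BSat R0 R1 val w (commAx2.subst s) := fun s w =>
    hL _ (hlog.subst _ s (hcomm (fun L' hL' => hL'.2.2.2.2.1))) w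
  refine ⟨CanonW R0 R1 val, _, _, _, ⟨_, (pure w : Ultrafilter W), rfl⟩,
    canon_good ?_ ?_ ?_ ?_ ?_ ?_, (canon_truth _ φ).2 ?_⟩
  · intro w ψ
    have hm : BForm.imp (.dia0 (.dia0 (.var 0))) (.dia0 (.var 0)) ∈ K43 := by
      refine ⟨by simp [BForm.imp, BForm.OnlyDia0], ?_⟩
      rintro T R _ ⟨_, ht, _⟩ v x
      rintro ⟨⟨y, hy, z, hz, h⟩, h'⟩
      exact h' ⟨z, ht _ _ _ hy hz, h⟩
    have := hK _ hm (fun _ => ψ) w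
    simp only [subst_imp, BForm.subst, sat_imp, sat_neg] at this ⊢
    tauto
  · intro w ψ χ
    have hm : BForm.imp (.dia0 (.var 0)) (.imp (.dia0 (.var 1))
        (.imp (.neg (.dia0 (.and (.var 0) (.var 1))))
          (.imp (.neg (.dia0 (.and (.var 0) (.dia0 (.var 1)))))
            (.dia0 (.and (.var 1) (.dia0 (.var 0))))))) ∈ K43 := by
      refine ⟨by simp [BForm.imp, BForm.OnlyDia0], ?_⟩
      rintro T R _ ⟨_, _, ht⟩ v x
      simp only [BForm.imp, BSat]
      rintro ⟨⟨y, hy, h1⟩, h⟩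
      apply h
      rintro ⟨⟨z, hz, h2⟩, h⟩
      apply h
      rintro ⟨h3, h⟩
      apply h
      rintro ⟨h4, h⟩
      apply h
      rcases ht y z with h | h | h
      · exact absurd ⟨y, hy, h1, z, h, h2⟩ h4
      · subst h
        exact absurd ⟨y, hy, h1, h2⟩ h3
      · exact ⟨z, hz, h2, y, h, h1⟩
    have := hK _ hm (fun n => if n = 0 then ψ else χ) w
    simp only [subst_imp, BForm.subst, if_true, if_neg one_ne_zero, sat_imp, sat_neg] at this ⊢
    tauto
  · intro w ψ
    have hm : BForm.imp (.var 0) (.neg (.dia1 (.neg (.dia1 (.var 0))))) ∈ DiffLogic := by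
      refine ⟨by simp [BForm.imp, BForm.OnlyDia1], ?_⟩
      intro D _ v x
      simp only [BForm.imp, BSat]
      rintro ⟨h1, h2⟩
      apply h2
      rintro ⟨y, hy, h⟩
      exact h ⟨x, hy.symm, h1⟩
    have := hDf _ hm (fun _ => ψ) w
    simp only [subst_imp, BForm.subst, sat_imp, sat_neg] at this ⊢
    tauto
  · intro w ψ
    have hm : BForm.imp (.dia1 (.dia1 (.var 0))) (.imp (.neg (.var 0)) (.dia1 (.var 0)))
        ∈ DiffLogic := by
      refine ⟨by simp [BForm.imp, BForm.OnlyDia1], ?_⟩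
      intro D _ v x
      simp only [BForm.imp, BSat]
      rintro ⟨⟨y, hy, z, hz, h1⟩, h2⟩
      apply h2
      rintro ⟨h3, h4⟩
      apply h4
      refine ⟨z, ?_, h1⟩
      rintro rfl
      exact h3 h1
    have := hDf _ hm (fun _ => ψ) w
    simp only [subst_imp, BForm.subst, sat_imp, sat_neg] at this ⊢
    tauto
  · intro w ψ
    have := hc1 (fun _ => .neg ψ) w
    simp only [commAx1, BForm.imp, BForm.box0, BForm.box1, BForm.subst, BSat, not_not] at this ⊢
    by_contra hcon
    push Not at hcon this
    obtain ⟨⟨a, ha, b, hb, hab⟩, h⟩ := hcon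
    exact this (fun v hv z hz hs => h v hv z hz hs) a ha b hb hab
  · intro w ψ
    have := hc2 (fun _ => .neg ψ) w
    simp only [commAx2, BForm.imp, BForm.box0, BForm.box1, BForm.subst, BSat, not_not] at this ⊢
    by_contra hcon
    push Not at hcon this
    obtain ⟨⟨a, ha, b, hb, hab⟩, h⟩ := hcon
    exact this (fun v hv z hz hs => h v hv z hz hs) a ha b hb hab
  · exact hw

end PartC

section PartD

/-! ## The reduction formula -/

abbrev Instr : Type := ℕ × CMOp × ℕ

def fN : BForm := .var 0
def fS : BForm := .var 1
def fC : BForm := .var 2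
def fI (t : Instr) : BForm := .var (3 + Encodable.encode t)

def bigAnd (l : List BForm) : BForm := l.foldr BForm.and BForm.top
/-- The negation of the disjunction of a list. -/
def bigNor (l : List BForm) : BForm := l.foldr (fun a b => .and (.neg a) b) BForm.top

def isDec (t : Instr) : Prop := t.2.1 = Sum.inr (Sum.inl (CMOp.counter t.2.1))
def isZero (t : Instr) : Prop := t.2.1 = Sum.inr (Sum.inr (CMOp.counter t.2.1))
/-- `t'` increments the counter of `t`. -/
def isIncOf (t t' : Instr) : Prop := t'.2.1 = Sum.inl (CMOp.counter t.2.1)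

instance (t : Instr) : Decidable (isDec t) := by unfold isDec; infer_instance
instance (t : Instr) : Decidable (isZero t) := by unfold isZero; infer_instance
instance (t t' : Instr) : Decidable (isIncOf t t') := by unfold isIncOf; infer_instance

/-- Labels are exclusive. -/
def pf1 (t t' : Instr) : BForm :=
  if t = t' then .top else .neg (.and (fI t) (fI t'))
/-- Consecutive instructions match. -/
def pf2 (t t' : Instr) : BForm :=
  if t'.2.2 = t.1 then .top
  else .neg (.and (.and fN (fI t)) (.dia0 (.and fS (.dia1 (.and fN (fI t'))))))
/-- The first instruction starts in `q`. -/
def pf3 (q : ℕ) (t : Instr) : BForm :=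
  if t.1 = q then .top else .neg (.and (.and fN (fI t)) (.neg (.dia0 .top)))
/-- Decrements point to increments. -/
def pf4 (t t' : Instr) : BForm :=
  if isDec t ∧ isIncOf t t' then .top
  else .neg (.and fC (.and (.dia1 (.and fN (fI t))) (.dia0 (.and fN (fI t')))))
/-- Decrements are realised. -/
def pf5 (t : Instr) : BForm :=
  if isDec t then .imp (.and fN (fI t)) (.dia1 fC) else .top
/-- Zero tests. -/
def pf6 (t t' : Instr) : BForm :=
  if isZero t ∧ isIncOf t t' then
    .neg (.and (.and fN (fI t)) (.dia1 (.and (.dia0 (.and fN (fI t'))) (.neg (.dia0 fC)))))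
  else .top

def pairForm (q : ℕ) (t t' : Instr) : BForm :=
  .and (pf1 t t') (.and (pf2 t t') (.and (pf3 q t) (.and (pf4 t t') (.and (pf5 t) (pf6 t t')))))

/-- The machine-independent global constraints. -/
def gridForm : BForm :=
  .and (.imp fN (.box1 (.neg fN)))
  (.and (.imp fN (.box0 (.neg fN)))
  (.and (.imp fS (.box0 (.neg fS)))
  (.and (.imp fN (.dia1 fS))
  (.and (.imp fN (.neg (.dia0 (.dia0 fS))))
  (.and (.imp fC (.box1 (.neg fC)))
  (.and (.imp fC (.box0 (.neg fC)))
    (.imp fC (.dia0 fN))))))))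

/-- The constraints at the root column. -/
def rootForm : BForm :=
  .and (.dia0 (.and fN (.neg (.dia0 .top))))
    (.boxP1 (.imp (.dia0 fS) (.dia0 (.and fN (.dia0 fS)))))

def labelForm (l : List Instr) : BForm := .neg (.and fN (bigNor (l.map fI)))

def machForm (q : ℕ) (l : List Instr) : BForm :=
  bigAnd (l.map fun t => bigAnd (l.map fun t' => pairForm q t t'))

def mainForm (q : ℕ) (l : List Instr) : BForm :=
  .and rootForm (.boxP1 (.box0 (.and gridForm (.and (labelForm l) (machForm q l)))))

section
variable {W : Type} {R0 R1 : W → W → Prop} {val : ℕ → W → Prop} {w : W}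

theorem sat_bigAnd {l : List BForm} :
    BSat R0 R1 val w (bigAnd l) ↔ ∀ φ ∈ l, BSat R0 R1 val w φ := by
  induction l with
  | nil => simp [bigAnd, sat_top]
  | cons a l ih =>
    have : bigAnd (a :: l) = .and a (bigAnd l) := rfl
    rw [this, sat_and, ih]; simp

theorem sat_bigNor {l : List BForm} :
    BSat R0 R1 val w (bigNor l) ↔ ∀ φ ∈ l, ¬ BSat R0 R1 val w φ := by
  induction l with
  | nil => simp [bigNor, sat_top]
  | cons a l ih =>
    have : bigNor (a :: l) = .and (.neg a) (bigNor l) := rfl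
    rw [this, sat_and, ih]; simp [sat_neg]

theorem sat_machForm {q : ℕ} {l : List Instr} :
    BSat R0 R1 val w (machForm q l) ↔ ∀ t ∈ l, ∀ t' ∈ l, BSat R0 R1 val w (pairForm q t t') := by
  simp only [machForm, sat_bigAnd, List.mem_map, forall_exists_index, and_imp,
    forall_apply_eq_imp_iff₂]

theorem sat_labelForm {l : List Instr} :
    BSat R0 R1 val w (labelForm l) ↔
      (BSat R0 R1 val w fN → ∃ t ∈ l, BSat R0 R1 val w (fI t)) := by
  simp only [labelForm, sat_neg, sat_and, sat_bigNor, List.mem_map, forall_exists_index, and_imp,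
    forall_apply_eq_imp_iff₂]
  push Not
  rfl
end

/-- Everything the formula says about a model, in the vocabulary of relations. -/
structure Enc {W : Type} (R0 R1 : W → W → Prop) (N S C : W → Prop) (I : Instr → W → Prop)
    (q : ℕ) (l : List Instr) (r : W) : Prop where
  start : ∃ n, R0 r n ∧ N n ∧ ∀ z, ¬ R0 n z
  next : ∀ y, r = y ∨ R1 r y → ∀ s, R0 y s → S s → ∃ n, R0 y n ∧ N n ∧ ∃ s', R0 n s' ∧ S s'
  N1 : ∀ y, r = y ∨ R1 r y → ∀ u, R0 y u → N u → ∀ v, R1 u v → ¬ N v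
  N0 : ∀ y, r = y ∨ R1 r y → ∀ u, R0 y u → N u → ∀ v, R0 u v → ¬ N v
  S0 : ∀ y, r = y ∨ R1 r y → ∀ u, R0 y u → S u → ∀ v, R0 u v → ¬ S v
  NS : ∀ y, r = y ∨ R1 r y → ∀ u, R0 y u → N u → ∃ v, R1 u v ∧ S v
  imm : ∀ y, r = y ∨ R1 r y → ∀ u, R0 y u → N u → ∀ v, R0 u v → ∀ s, R0 v s → ¬ S s
  C1 : ∀ y, r = y ∨ R1 r y → ∀ u, R0 y u → C u → ∀ v, R1 u v → ¬ C v
  C0 : ∀ y, r = y ∨ R1 r y → ∀ u, R0 y u → C u → ∀ v, R0 u v → ¬ C v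
  CN : ∀ y, r = y ∨ R1 r y → ∀ u, R0 y u → C u → ∃ v, R0 u v ∧ N v
  lab : ∀ y, r = y ∨ R1 r y → ∀ u, R0 y u → N u → ∃ t ∈ l, I t u
  P1 : ∀ y, r = y ∨ R1 r y → ∀ u, R0 y u → ∀ t ∈ l, ∀ t' ∈ l, I t u → I t' u → t = t'
  P2 : ∀ y, r = y ∨ R1 r y → ∀ u, R0 y u → ∀ t ∈ l, ∀ t' ∈ l, N u → I t u →
    ∀ s, R0 u s → S s → ∀ n, R1 s n → N n → I t' n → t'.2.2 = t.1
  P3 : ∀ y, r = y ∨ R1 r y → ∀ u, R0 y u → ∀ t ∈ l, N u → I t u → (∀ z, ¬ R0 u z) → t.1 = q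
  P4 : ∀ y, r = y ∨ R1 r y → ∀ u, R0 y u → ∀ t ∈ l, ∀ t' ∈ l, C u → ∀ n, R1 u n → N n → I t n →
    ∀ m, R0 u m → N m → I t' m → isDec t ∧ isIncOf t t'
  P5 : ∀ y, r = y ∨ R1 r y → ∀ u, R0 y u → ∀ t ∈ l, isDec t → N u → I t u → ∃ v, R1 u v ∧ C v
  P6 : ∀ y, r = y ∨ R1 r y → ∀ u, R0 y u → ∀ t ∈ l, ∀ t' ∈ l, isZero t → isIncOf t t' →
    N u → I t u → ∀ a, R1 u a → ∀ m, R0 a m → N m → I t' m → ∃ c, R0 a c ∧ C c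

theorem sat_mainForm {W : Type} {R0 R1 : W → W → Prop} {val : ℕ → W → Prop} {r : W}
    {q : ℕ} {l : List Instr} :
    BSat R0 R1 val r (mainForm q l) ↔
      Enc R0 R1 (val 0) (val 1) (val 2) (fun t => val (3 + Encodable.encode t)) q l r := by
  have e1 : ∀ u t t', BSat R0 R1 val u (pf1 t t') ↔
      (BSat R0 R1 val u (fI t) → BSat R0 R1 val u (fI t') → t = t') := by
    intro u t t'; unfold pf1; split_ifs with h <;> simp [sat_top, sat_neg, sat_and, h]
  have e2 : ∀ u t t', BSat R0 R1 val u (pf2 t t') ↔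
      (val 0 u → BSat R0 R1 val u (fI t) → ∀ s, R0 u s → val 1 s → ∀ n, R1 s n → val 0 n →
        BSat R0 R1 val n (fI t') → t'.2.2 = t.1) := by
    intro u t t'; unfold pf2
    split_ifs with h <;>
      simp [sat_top, sat_neg, sat_and, h, sat_dia0, sat_dia1, fN, fS, sat_var]
  have e3 : ∀ u t, BSat R0 R1 val u (pf3 q t) ↔
      (val 0 u → BSat R0 R1 val u (fI t) → (∀ z, ¬ R0 u z) → t.1 = q) := by
    intro u t; unfold pf3
    split_ifs with h <;>
      simp [sat_top, sat_neg, sat_and, h, sat_dia0, fN, sat_var]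
  have e4 : ∀ u t t', BSat R0 R1 val u (pf4 t t') ↔
      (val 2 u → ∀ n, R1 u n → val 0 n → BSat R0 R1 val n (fI t) → ∀ m, R0 u m → val 0 m →
        BSat R0 R1 val m (fI t') → isDec t ∧ isIncOf t t') := by
    intro u t t'; unfold pf4
    split_ifs with h
    · simp [h, sat_top]
    · simp [h, sat_neg, sat_and, sat_dia0, sat_dia1, fN, fC, sat_var]
  have e5 : ∀ u t, BSat R0 R1 val u (pf5 t) ↔
      (isDec t → val 0 u → BSat R0 R1 val u (fI t) → ∃ v, R1 u v ∧ val 2 v) := by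
    intro u t; unfold pf5
    split_ifs with h <;>
      simp [sat_top, sat_imp, sat_and, h, sat_dia1, fN, fC, sat_var]
  have e6 : ∀ u t t', BSat R0 R1 val u (pf6 t t') ↔
      (isZero t → isIncOf t t' → val 0 u → BSat R0 R1 val u (fI t) → ∀ a, R1 u a →
        ∀ m, R0 a m → val 0 m → BSat R0 R1 val m (fI t') → ∃ c, R0 a c ∧ val 2 c) := by
    intro u t t'; unfold pf6
    split_ifs with h
    · simp [h, sat_neg, sat_and, sat_dia0, sat_dia1, fN, fC, sat_var]
    · rw [sat_top, true_iff]; exact fun h1 h2 => absurd ⟨h1, h2⟩ h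
  simp only [mainForm, rootForm, gridForm, sat_and, sat_boxP1, sat_box0, sat_box1, sat_imp,
    sat_machForm, sat_labelForm, pairForm, e1, e2, e3, e4, e5, e6, sat_neg, sat_dia0, sat_dia1,
    fN, fS, fC, fI, sat_var, sat_top]
  constructor
  · rintro ⟨⟨h1, h2⟩, h3⟩
    constructor
    · obtain ⟨n, hn, hn1, hn2⟩ := h1
      exact ⟨n, hn, hn1, fun z hz => hn2 ⟨z, hz, trivial⟩⟩
    · intro y hy s hs hs'
      exact h2 y hy ⟨s, hs, hs'⟩
    · exact fun y hy u hu => (h3 y hy u hu).1.1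
    · exact fun y hy u hu => (h3 y hy u hu).1.2.1
    · exact fun y hy u hu => (h3 y hy u hu).1.2.2.1
    · exact fun y hy u hu => (h3 y hy u hu).1.2.2.2.1
    · exact fun y hy u hu hN v hv s hs hS =>
        (h3 y hy u hu).1.2.2.2.2.1 hN ⟨v, hv, s, hs, hS⟩
    · exact fun y hy u hu => (h3 y hy u hu).1.2.2.2.2.2.1
    · exact fun y hy u hu => (h3 y hy u hu).1.2.2.2.2.2.2.1
    · exact fun y hy u hu => (h3 y hy u hu).1.2.2.2.2.2.2.2
    · exact fun y hy u hu => (h3 y hy u hu).2.1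
    · exact fun y hy u hu t ht t' ht' => ((h3 y hy u hu).2.2 t ht t' ht').1
    · exact fun y hy u hu t ht t' ht' => ((h3 y hy u hu).2.2 t ht t' ht').2.1
    · exact fun y hy u hu t ht => ((h3 y hy u hu).2.2 t ht t ht).2.2.1
    · exact fun y hy u hu t ht t' ht' => ((h3 y hy u hu).2.2 t ht t' ht').2.2.2.1
    · exact fun y hy u hu t ht => ((h3 y hy u hu).2.2 t ht t ht).2.2.2.2.1
    · exact fun y hy u hu t ht t' ht' => ((h3 y hy u hu).2.2 t ht t' ht').2.2.2.2.2
  · intro h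
    refine ⟨⟨?_, ?_⟩, ?_⟩
    · obtain ⟨n, hn, hn1, hn2⟩ := h.start
      exact ⟨n, hn, hn1, fun ⟨z, hz, _⟩ => hn2 z hz⟩
    · rintro y hy ⟨s, hs, hs'⟩
      exact h.next y hy s hs hs'
    · intro y hy u hu
      refine ⟨⟨h.N1 y hy u hu, h.N0 y hy u hu, h.S0 y hy u hu, h.NS y hy u hu, ?_,
        h.C1 y hy u hu, h.C0 y hy u hu, h.CN y hy u hu⟩, h.lab y hy u hu, ?_⟩
      · rintro hN ⟨v, hv, s, hs, hS⟩
        exact h.imm y hy u hu hN v hv s hs hS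
      · intro t ht t' ht'
        exact ⟨h.P1 y hy u hu t ht t' ht', h.P2 y hy u hu t ht t' ht', h.P3 y hy u hu t ht,
          h.P4 y hy u hu t ht t' ht', h.P5 y hy u hu t ht, h.P6 y hy u hu t ht t' ht'⟩

end PartD

section PartE

/-! ## From models to runs -/

section Extract
variable {W : Type} {R0 R1 : W → W → Prop} {N S C : W → Prop} {I : Instr → W → Prop}
  {q : ℕ} {l : List Instr} {r : W}

/-- Being in the same column. -/
def Col (R1 : W → W → Prop) (x y : W) : Prop := x = y ∨ R1 x y

theorem Col.symm' (hF : GoodFrame R0 R1) {x y : W} (h : Col R1 x y) : Col R1 y x := by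
  rcases h with rfl | h
  · exact Or.inl rfl
  · exact Or.inr (hF.symm _ _ h)

theorem Col.trans' (hF : GoodFrame R0 R1) {x y z : W} (h : Col R1 x y) (h' : Col R1 y z) :
    Col R1 x z := by
  rcases h with rfl | h
  · exact h'
  · rcases h' with rfl | h'
    · exact Or.inr h
    · exact hF.ptrans _ _ _ h h'

theorem Col.up (hF : GoodFrame R0 R1) {x y z : W} (h : R0 x y) (h' : Col R1 y z) :
    ∃ w, Col R1 x w ∧ R0 w z := by
  rcases h' with rfl | h'
  · exact ⟨x, Or.inl rfl, h⟩
  · obtain ⟨w, h1, h2⟩ := hF.comm _ _ _ h h'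
    exact ⟨w, Or.inr h1, h2⟩

theorem Col.down (hF : GoodFrame R0 R1) {x y z : W} (h : Col R1 x y) (h' : R0 y z) :
    ∃ w, R0 x w ∧ Col R1 w z := by
  rcases h with rfl | h
  · exact ⟨z, h', Or.inl rfl⟩
  · obtain ⟨w, h1, h2⟩ := hF.comm' _ _ _ h h'
    exact ⟨w, h1, Or.inr h2⟩

/-- Points seen from the root column. -/
def Seen (R0 R1 : W → W → Prop) (r u : W) : Prop := ∃ y, (r = y ∨ R1 r y) ∧ R0 y u

theorem Seen.col (hF : GoodFrame R0 R1) {u v : W} (h : Seen R0 R1 r u) (hc : Col R1 u v) :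
    Seen R0 R1 r v := by
  obtain ⟨y, hy, hu⟩ := h
  obtain ⟨w, hw, hv⟩ := Col.up hF hu hc
  exact ⟨w, Col.trans' hF hy hw, hv⟩

theorem Seen.fut (hF : GoodFrame R0 R1) {u v : W} (h : Seen R0 R1 r u) (hc : R0 u v) :
    Seen R0 R1 r v := by
  obtain ⟨y, hy, hu⟩ := h
  exact ⟨y, hy, hF.trans _ _ _ hu hc⟩

/-- The sequence of diagonal points. -/
structure Diag (R0 R1 : W → W → Prop) (N S : W → Prop) (r : W) (n s : ℕ → W) : Prop where
  zero : ∀ z, ¬ R0 (n 0) z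
  seen : ∀ k, Seen R0 R1 r (n k)
  N : ∀ k, N (n k)
  S : ∀ k, S (s k)
  col : ∀ k, R1 (n k) (s k)
  next : ∀ k, R0 (n (k+1)) (s k)
  imm : ∀ k z, R0 (n (k+1)) z → ¬ R0 z (s k)

theorem exists_diag (hF : GoodFrame R0 R1) (hE : Enc R0 R1 N S C I q l r) :
    ∃ n s, Diag R0 R1 N S r n s := by
  have step : ∀ x : {x : W // Seen R0 R1 r x ∧ N x}, ∃ (x' : {x : W // Seen R0 R1 r x ∧ N x})
      (s : W), S s ∧ R1 x.1 s ∧ R0 x'.1 s ∧ ∀ z, R0 x'.1 z → ¬ R0 z s := by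
    rintro ⟨x, hx, hN⟩
    obtain ⟨y, hy, hyx⟩ := hx
    obtain ⟨s, hs, hS⟩ := hE.NS y hy x hyx hN
    obtain ⟨y', hy', hy's⟩ := Seen.col hF ⟨y, hy, hyx⟩ (Or.inr hs)
    obtain ⟨n, hn, hNn, s', hs', hS'⟩ := hE.next y' hy' s hy's hS
    have hss : s' = s := by
      have h1 := hF.trans _ _ _ hn hs'
      rcases hF.wcon _ _ _ h1 hy's with h | h | h
      · exact h
      · exact absurd hS (hE.S0 y' hy' s' h1 hS' s h)
      · exact absurd hS' (hE.S0 y' hy' s hy's hS s' h)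
    subst hss
    refine ⟨⟨n, ⟨y', hy', hn⟩, hNn⟩, s', hS, hs, hs', ?_⟩
    intro z hz hzs
    exact hE.imm y' hy' n hn hNn z hz s' hzs hS
  choose f g hS hcol hnext himm using step
  obtain ⟨n0, h0, hN0, hz⟩ := hE.start
  let seq : ℕ → {x : W // Seen R0 R1 r x ∧ N x} :=
    fun k => f^[k] ⟨n0, ⟨r, Or.inl rfl, h0⟩, hN0⟩
  have hseq : ∀ k, seq (k+1) = f (seq k) := fun k => Function.iterate_succ_apply' _ _ _
  refine ⟨fun k => (seq k).1, fun k => g (seq k), hz, fun k => (seq k).2.1, fun k => (seq k).2.2,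
    fun k => hS _, fun k => hcol _, ?_, ?_⟩
  · intro k
    simp only [hseq]
    exact hnext _
  · intro k z
    simp only [hseq]
    exact himm _ z

variable {n s : ℕ → W}

theorem Diag.below (hF : GoodFrame R0 R1) (hD : Diag R0 R1 N S r n s) :
    ∀ k u z, Col R1 (n k) u → R0 u z → ∃ j < k, Col R1 (n j) z := by
  intro k
  induction k with
  | zero =>
    intro u z hu hz
    obtain ⟨w, hw, _⟩ := Col.down hF hu hz
    exact absurd hw (hD.zero w)
  | succ k ih =>
    intro u z hu hz
    obtain ⟨w, hw, hwz⟩ := Col.down hF hu hz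
    suffices h : ∃ j < k+1, Col R1 (n j) w by
      obtain ⟨j, hj, h⟩ := h
      exact ⟨j, hj, Col.trans' hF h hwz⟩
    rcases hF.wcon _ _ _ (hD.next k) hw with h | h | h
    · subst h
      exact ⟨k, Nat.lt_succ_self k, Or.inr (hD.col k)⟩
    · obtain ⟨j, hj, h'⟩ := ih (s k) w (Or.inr (hD.col k)) h
      exact ⟨j, Nat.lt_succ_of_lt hj, h'⟩
    · exact absurd h (hD.imm k w hw)

theorem Diag.above (hF : GoodFrame R0 R1) (hD : Diag R0 R1 N S r n s) {j k : ℕ} (hjk : j < k) :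
    ∀ v, Col R1 (n j) v → ∃ u, Col R1 (n k) u ∧ R0 u v := by
  induction k with
  | zero => omega
  | succ k ih =>
    intro v hv
    have key : ∀ v, Col R1 (n k) v → ∃ u, Col R1 (n (k+1)) u ∧ R0 u v := fun v hv =>
      Col.up hF (hD.next k) (Col.trans' hF (Or.inr (hF.symm _ _ (hD.col k))) hv)
    rcases Nat.lt_succ_iff_lt_or_eq.1 hjk with h | rfl
    · obtain ⟨u, hu, huv⟩ := ih h v hv
      obtain ⟨u', hu', hu''⟩ := key u hu
      exact ⟨u', hu', hF.trans _ _ _ hu'' huv⟩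
    · exact key v hv

theorem Diag.uniq (hE : Enc R0 R1 N S C I q l r) (hD : Diag R0 R1 N S r n s) {k : ℕ} {u : W}
    (hc : Col R1 (n k) u) (hu : N u) : n k = u := by
  rcases hc with h | h
  · exact h
  · obtain ⟨y, hy, hyn⟩ := hD.seen k
    exact absurd hu (hE.N1 y hy _ hyn (hD.N k) u h)

theorem Diag.irr (hF : GoodFrame R0 R1) (hE : Enc R0 R1 N S C I q l r)
    (hD : Diag R0 R1 N S r n s) (k : ℕ) :
    ∀ u v, Col R1 (n k) u → Col R1 (n k) v → ¬ R0 u v := by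
  induction k using Nat.strong_induction_on with
  | _ k ih =>
    intro u v hu hv huv
    obtain ⟨j, hj, hjv⟩ := hD.below hF k u v hu huv
    have hjk : n j = n k :=
      hD.uniq hE (Col.trans' hF hjv (Col.symm' hF hv)) (hD.N k)
    obtain ⟨a, ha, hav⟩ := hD.above hF hj v hjv
    exact ih j hj a v (hjk ▸ ha) hjv hav

theorem Diag.inj (hF : GoodFrame R0 R1) (hE : Enc R0 R1 N S C I q l r)
    (hD : Diag R0 R1 N S r n s) {m k : ℕ} {a b : W}
    (ha : Col R1 (n m) a) (hb : Col R1 (n m) b) (hak : R0 a (n k)) (hbk : R0 b (n k)) :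
    a = b := by
  rcases Col.trans' hF (Col.symm' hF ha) hb with h | h
  · exact h
  · exfalso
    obtain ⟨z, hz, hzk⟩ := hF.comm' _ _ _ (hF.symm _ _ h) hak
    have hkz := hF.symm _ _ hzk
    rcases hF.wcon _ _ _ hz hbk with h | h | h
    · subst h
      obtain ⟨y, hy, hyn⟩ := hD.seen k
      exact hE.N1 y hy _ hyn (hD.N k) _ hkz (hD.N k)
    · exact hD.irr hF hE k _ _ (Or.inr hkz) (Or.inl rfl) h
    · exact hD.irr hF hE k _ _ (Or.inl rfl) (Or.inr hkz) h

/-- Combinatorial content of a model: labels and a matching of decrements with increments. -/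
theorem exists_labels (hF : GoodFrame R0 R1) (hE : Enc R0 R1 N S C I q l r) :
    ∃ (t : ℕ → Instr) (D : ℕ → ℕ → Prop), (∀ k, t k ∈ l) ∧ (t 0).1 = q ∧
      (∀ k, (t k).2.2 = (t (k+1)).1) ∧
      (∀ j, isDec (t j) → ∃ k < j, D j k) ∧
      (∀ j k, D j k → isDec (t j) ∧ isIncOf (t j) (t k)) ∧
      (∀ i j k, D i k → D j k → i = j) ∧
      (∀ j k k', D j k → D j k' → k = k') ∧
      (∀ m k, k < m → isZero (t m) → isIncOf (t m) (t k) → ∃ j < m, D j k) := by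
  obtain ⟨n, s, hD⟩ := exists_diag hF hE
  have hlab : ∀ k, ∃ t ∈ l, I t (n k) := fun k => by
    obtain ⟨y, hy, h⟩ := hD.seen k
    exact hE.lab y hy _ h (hD.N k)
  choose t htl htI using hlab
  have Nrow : ∀ a k k', Seen R0 R1 r a → R0 a (n k) → R0 a k' → N k' → n k = k' := by
    intro a k k' ⟨y, hy, hya⟩ h1 h2 h3
    rcases hF.wcon _ _ _ h1 h2 with h | h | h
    · exact h
    · exact absurd h3 (hE.N0 y hy _ (hF.trans _ _ _ hya h1) (hD.N k) _ h)
    · exact absurd (hD.N k) (hE.N0 y hy _ (hF.trans _ _ _ hya h2) h3 _ h)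
  have ninj : ∀ i j, n i = n j → i = j := by
    have h : ∀ i j, i < j → n i ≠ n j := by
      intro i j hij h
      obtain ⟨u, hu, hu'⟩ := hD.above hF hij (n i) (Or.inl rfl)
      exact hD.irr hF hE i _ _ (h ▸ hu) (Or.inl rfl) hu'
    intro i j hij
    rcases lt_trichotomy i j with h1 | h1 | h1
    · exact absurd hij (h i j h1)
    · exact h1
    · exact absurd hij.symm (h j i h1)
  refine ⟨t, fun j k => ∃ b, R1 (n j) b ∧ C b ∧ R0 b (n k), htl, ?_, ?_, ?_, ?_, ?_, ?_, ?_⟩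
  · obtain ⟨y, hy, h⟩ := hD.seen 0
    exact hE.P3 y hy _ h _ (htl 0) (hD.N 0) (htI 0) hD.zero
  · intro k
    obtain ⟨y, hy, h⟩ := hD.seen (k+1)
    exact hE.P2 y hy _ h _ (htl (k+1)) _ (htl k) (hD.N _) (htI _) _ (hD.next k) (hD.S k) _
      (hF.symm _ _ (hD.col k)) (hD.N k) (htI k)
  · intro j hj
    obtain ⟨y, hy, h⟩ := hD.seen j
    obtain ⟨b, hb, hC⟩ := hE.P5 y hy _ h _ (htl j) hj (hD.N j) (htI j)
    obtain ⟨y', hy', h'⟩ := Seen.col hF (hD.seen j) (Or.inr hb)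
    obtain ⟨v, hv, hNv⟩ := hE.CN y' hy' b h' hC
    obtain ⟨k, hk, hkv⟩ := hD.below hF j b v (Or.inr hb) hv
    have := hD.uniq hE hkv hNv
    subst this
    exact ⟨k, hk, b, hb, hC, hv⟩
  · rintro j k ⟨b, hb, hC, hbk⟩
    obtain ⟨y', hy', h'⟩ := Seen.col hF (hD.seen j) (Or.inr hb)
    exact hE.P4 y' hy' b h' _ (htl j) _ (htl k) hC _ (hF.symm _ _ hb) (hD.N j) (htI j) _ hbk
      (hD.N k) (htI k)
  · have key : ∀ i j k, i < j → (∃ b, R1 (n i) b ∧ C b ∧ R0 b (n k)) →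
        (∃ b, R1 (n j) b ∧ C b ∧ R0 b (n k)) → False := by
      rintro i j k hij ⟨b, hb, hC, hbk⟩ ⟨b', hb', hC', hbk'⟩
      obtain ⟨a, ha, hab⟩ := hD.above hF hij b (Or.inr hb)
      have := hD.inj hF hE ha (Or.inr hb') (hF.trans _ _ _ hab hbk) hbk'
      subst this
      obtain ⟨y', hy', h'⟩ := Seen.col hF (hD.seen j) (Or.inr hb')
      exact hE.C0 y' hy' a h' hC' b hab hC
    intro i j k hi hj
    rcases lt_trichotomy i j with h | h | h
    · exact (key i j k h hi hj).elim
    · exact h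
    · exact (key j i k h hj hi).elim
  · rintro j k k' ⟨b, hb, hC, hbk⟩ ⟨b', hb', hC', hbk'⟩
    have hs := Seen.col hF (hD.seen j) (Or.inr hb)
    have hbb : b = b' := by
      rcases Col.trans' hF (Or.inr (hF.symm _ _ hb)) (Or.inr hb' : Col R1 _ _) with h | h
      · exact h
      · obtain ⟨y', hy', h'⟩ := hs
        exact absurd hC' (hE.C1 y' hy' b h' hC b' h)
    subst hbb
    exact ninj _ _ (Nrow b k (n k') hs hbk hbk' (hD.N k'))
  · intro m k hkm hz hinc
    obtain ⟨a, ha, hak⟩ := hD.above hF hkm (n k) (Or.inl rfl)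
    obtain ⟨y, hy, h⟩ := hD.seen m
    have hma : R1 (n m) a := by
      rcases ha with rfl | ha
      · exact absurd (hD.N k) (hE.N0 y hy _ h (hD.N m) _ hak)
      · exact ha
    obtain ⟨c, hac, hC⟩ := hE.P6 y hy _ h _ (htl m) _ (htl k) hz hinc (hD.N m) (htI m) a hma _ hak
      (hD.N k) (htI k)
    have hsa := Seen.col hF (hD.seen m) ha
    obtain ⟨j, hj, hjc⟩ := hD.below hF m a c ha hac
    obtain ⟨y', hy', h'⟩ := Seen.fut hF hsa hac
    obtain ⟨v, hcv, hNv⟩ := hE.CN y' hy' c h' hC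
    have := Nrow a k v hsa hak (hF.trans _ _ _ hac hcv) hNv
    subst this
    refine ⟨j, hj, c, ?_, hC, hcv⟩
    rcases hjc with rfl | hjc
    · exact absurd (hD.N k) (hE.N0 y' hy' _ h' (hD.N j) _ hcv)
    · exact hjc

end Extract

/-! ## From labels to runs -/

theorem run_of_labels {l : List Instr} {q : ℕ} {t : ℕ → Instr} {D : ℕ → ℕ → Prop}
    (htl : ∀ k, t k ∈ l) (h0 : (t 0).1 = q) (hst : ∀ k, (t k).2.2 = (t (k+1)).1)
    (hdec : ∀ j, isDec (t j) → ∃ k < j, D j k)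
    (hD : ∀ j k, D j k → isDec (t j) ∧ isIncOf (t j) (t k))
    (hinj : ∀ i j k, D i k → D j k → i = j)
    (hfun : ∀ j k k', D j k → D j k' → k = k')
    (hzero : ∀ m k, k < m → isZero (t m) → isIncOf (t m) (t k) → ∃ j < m, D j k)
    (M : CMDesc) (hM : M.2.2.2 = l) :
    ∃ ρ : ℕ → CMConfig, ρ 0 = zeroConfig q ∧ ∀ n, CMStep M (ρ n) (ρ (n+1)) := by
  classical
  let inc : ℕ → ℕ → Prop := fun i k => (t k).2.1 = Sum.inl i
  let dec : ℕ → ℕ → Prop := fun i k => (t k).2.1 = Sum.inr (Sum.inl i)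
  have hdec' : ∀ i k, dec i k → isDec (t k) ∧ (t k).2.1.counter = i := by
    intro i k h
    have h' : (t k).2.1 = Sum.inr (Sum.inl i) := h
    simp [isDec, h', CMOp.counter]
  have le : ∀ i m, Nat.count (dec i) (m+1) ≤ Nat.count (inc i) m := by
    intro i m
    rw [Nat.count_eq_card_filter_range, Nat.count_eq_card_filter_range]
    have hex : ∀ j, ∃ k, dec i j → k < j ∧ D j k := by
      intro j
      by_cases h : dec i j
      · obtain ⟨k, hk⟩ := hdec j (hdec' i j h).1
        exact ⟨k, fun _ => hk⟩
      · exact ⟨0, fun h' => absurd h' h⟩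
    choose d hd using hex
    refine Finset.card_le_card_of_injOn d ?_ ?_
    · intro j hj
      simp only [Finset.coe_filter, Finset.mem_range, Set.mem_ofPred_eq] at hj ⊢
      have h1 := hd j hj.2
      refine ⟨by omega, ?_⟩
      have h2 := (hD j _ h1.2).2
      unfold isIncOf at h2
      rw [(hdec' i j hj.2).2] at h2
      exact h2
    · intro j hj j' hj' heq
      simp only [Finset.coe_filter, Finset.mem_range, Set.mem_ofPred_eq] at hj hj'
      have h1 := (hd j hj.2).2
      have h2 := (hd j' hj'.2).2
      rw [← heq] at h2
      exact hinj _ _ _ h1 h2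
  have le' : ∀ i m, Nat.count (dec i) m ≤ Nat.count (inc i) m := fun i m =>
    le_trans (Nat.count_monotone _ (Nat.le_succ m)) (le i m)
  have ge : ∀ i m, (t m).2.1 = Sum.inr (Sum.inr i) →
      Nat.count (inc i) m ≤ Nat.count (dec i) m := by
    intro i m hm
    have hz : isZero (t m) := by simp [isZero, hm, CMOp.counter]
    rw [Nat.count_eq_card_filter_range, Nat.count_eq_card_filter_range]
    have hex : ∀ k, ∃ j, k < m → inc i k → j < m ∧ D j k := by
      intro k
      by_cases h : k < m ∧ inc i k
      · obtain ⟨j, hj⟩ := hzero m k h.1 hz (by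
          have h2 : (t k).2.1 = Sum.inl i := h.2
          simp [isIncOf, hm, CMOp.counter, h2])
        exact ⟨j, fun _ _ => hj⟩
      · exact ⟨0, fun h1 h2 => absurd ⟨h1, h2⟩ h⟩
    choose d hd using hex
    refine Finset.card_le_card_of_injOn d ?_ ?_
    · intro k hk
      simp only [Finset.coe_filter, Finset.mem_range, Set.mem_ofPred_eq] at hk ⊢
      obtain ⟨h1, h2⟩ := hd k hk.1 hk.2
      refine ⟨h1, ?_⟩
      obtain ⟨h3, h4⟩ := hD _ _ h2
      have h5 : (t k).2.1 = Sum.inl i := hk.2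
      unfold isIncOf at h4
      rw [h5] at h4
      unfold isDec at h3
      rw [← Sum.inl.inj h4] at h3
      exact h3
    · intro j hj j' hj' heq
      simp only [Finset.coe_filter, Finset.mem_range, Set.mem_ofPred_eq] at hj hj'
      have h1 := (hd j hj.1 hj.2).2
      have h2 := (hd j' hj'.1 hj'.2).2
      rw [← heq] at h2
      exact hfun _ _ _ h1 h2
  refine ⟨fun m => ((t m).1, fun i => Nat.count (inc i) m - Nat.count (dec i) m), ?_, ?_⟩
  · simp [zeroConfig, h0]
  · intro m
    refine ⟨(t m).2.1, (t m).2.2, ?_, (hst m).symm, ?_⟩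
    · rw [hM]; exact htl m
    · rcases hop : (t m).2.1 with i | i | i
      · have e1 : ∀ j, inc j m ↔ i = j := fun j => by simp [inc, hop]
        have e2 : ∀ j, ¬ dec j m := fun j => by simp [dec, hop]
        refine ⟨?_, ?_⟩
        · have := le' i m
          simp only [Nat.count_succ, e1, e2, if_true, if_false]
          omega
        · intro j hj
          simp only [Nat.count_succ, e1, e2, if_neg hj.symm, if_false, add_zero]
      · have e1 : ∀ j, ¬ inc j m := fun j => by simp [inc, hop]
        have e2 : ∀ j, dec j m ↔ i = j := fun j => by simp [dec, hop]
        have h1 := le i m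
        simp only [Nat.count_succ, e2, if_true] at h1
        refine ⟨?_, ?_, ?_⟩
        · simp only; omega
        · simp only [Nat.count_succ, e1, e2, if_true, if_false]
          omega
        · intro j hj
          simp only [Nat.count_succ, e1, e2, if_neg hj.symm, if_false, add_zero]
      · have e1 : ∀ j, ¬ inc j m := fun j => by simp [inc, hop]
        have e2 : ∀ j, ¬ dec j m := fun j => by simp [dec, hop]
        refine ⟨?_, ?_⟩
        · have := ge i m hop
          simp only; omega
        · intro j
          simp only [Nat.count_succ, e1, e2, if_false, add_zero]

end PartE

section PartF

/-! ## From a run to a model -/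

theorem exists_of_lt_count {p : ℕ → Prop} [DecidablePred p] {k m : ℕ} (h : m < Nat.count p k) :
    ∃ b < k, p b ∧ Nat.count p b = m := by
  induction k with
  | zero => simp at h
  | succ k ih =>
    rw [Nat.count_succ] at h
    by_cases hm : m < Nat.count p k
    · obtain ⟨b, hb, h1, h2⟩ := ih hm
      exact ⟨b, by omega, h1, h2⟩
    · by_cases hp : p k
      · rw [if_pos hp] at h
        exact ⟨k, by omega, hp, by omega⟩
      · rw [if_neg hp] at h; omega

theorem labels_of_run {M : CMDesc} {q : ℕ} {ρ : ℕ → CMConfig} (h0 : ρ 0 = zeroConfig q)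
    (hs : ∀ n, CMStep M (ρ n) (ρ (n+1))) :
    ∃ (t : ℕ → Instr) (d : ℕ → ℕ), (∀ k, t k ∈ M.2.2.2) ∧ (t 0).1 = q ∧
      (∀ k, (t k).2.2 = (t (k+1)).1) ∧
      (∀ k, isDec (t k) → d k < k ∧ isIncOf (t k) (t (d k))) ∧
      (∀ j k, isDec (t j) → isDec (t k) → d j = d k → j = k) ∧
      (∀ k b, isZero (t k) → isIncOf (t k) (t b) → b < k → ∃ j < k, isDec (t j) ∧ d j = b) := by
  choose op q' hmem hq hop using hs
  let t : ℕ → Instr := fun n => ((ρ n).1, op n, q' n)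
  let inc : ℕ → ℕ → Prop := fun i n => op n = Sum.inl i
  let dec : ℕ → ℕ → Prop := fun i n => op n = Sum.inr (Sum.inl i)
  have i1 : ∀ i, DecidablePred (inc i) := fun i n => inferInstanceAs (Decidable (op n = _))
  have i2 : ∀ i, DecidablePred (dec i) := fun i n => inferInstanceAs (Decidable (op n = _))
  have inv : ∀ n i, (ρ n).2 i + Nat.count (dec i) n = Nat.count (inc i) n := by
    intro n i
    induction n with
    | zero => simp [h0, zeroConfig]
    | succ n ih =>
      have key : (op n = Sum.inl i ∧ ¬ op n = Sum.inr (Sum.inl i) ∧ (ρ (n+1)).2 i = (ρ n).2 i + 1) ∨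
          (¬ op n = Sum.inl i ∧ op n = Sum.inr (Sum.inl i) ∧ (ρ (n+1)).2 i + 1 = (ρ n).2 i) ∨
          (¬ op n = Sum.inl i ∧ ¬ op n = Sum.inr (Sum.inl i) ∧ (ρ (n+1)).2 i = (ρ n).2 i) := by
        have := hop n
        generalize op n = o at this
        rcases o with j | j | j
        · by_cases hj : j = i
          · subst hj; exact Or.inl ⟨rfl, by simp, this.1⟩
          · exact Or.inr (Or.inr ⟨by simpa using hj, by simp, this.2 i (Ne.symm hj)⟩)
        · by_cases hj : j = i
          · subst hj; exact Or.inr (Or.inl ⟨by simp, rfl, this.2.1⟩)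
          · exact Or.inr (Or.inr ⟨by simp, by simpa using hj, this.2.2 i (Ne.symm hj)⟩)
        · exact Or.inr (Or.inr ⟨by simp, by simp, this.2 i⟩)
      have c1 : dec i n ↔ op n = Sum.inr (Sum.inl i) := Iff.rfl
      have c2 : inc i n ↔ op n = Sum.inl i := Iff.rfl
      rw [← c1, ← c2] at key
      rw [Nat.count_succ, Nat.count_succ]
      rcases key with ⟨k1, k2, k3⟩ | ⟨k1, k2, k3⟩ | ⟨k1, k2, k3⟩ <;>
        simp only [k1, k2, if_true, if_false] <;> omega
  have hd : ∀ n, ∃ b, ∀ i, dec i n → b < n ∧ inc i b ∧ Nat.count (inc i) b = Nat.count (dec i) n := by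
    intro n
    by_cases h : ∃ i, dec i n
    · obtain ⟨i, hi⟩ := h
      have hp : 0 < (ρ n).2 i := by
        have := hop n
        have hi' : op n = Sum.inr (Sum.inl i) := hi
        rw [hi'] at this
        exact this.1
      have := inv n i
      obtain ⟨b, hb⟩ := exists_of_lt_count (p := inc i) (k := n) (m := Nat.count (dec i) n) (by omega)
      refine ⟨b, fun i' hi' => ?_⟩
      have : i' = i := by
        have h1 : op n = _ := hi
        have h2 : op n = _ := hi'
        rw [h1] at h2
        simpa using h2.symm
      subst this; exact hb
    · exact ⟨0, fun i hi => absurd ⟨i, hi⟩ h⟩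
  choose d hd using hd
  have hdec : ∀ k, isDec (t k) → dec (CMOp.counter (op k)) k := fun k h => h
  refine ⟨t, d, hmem, by simp [t, h0, zeroConfig], fun k => (hq k).symm, ?_, ?_, ?_⟩
  · intro k hk
    obtain ⟨h1, h2, _⟩ := hd k _ (hdec k hk)
    exact ⟨h1, h2⟩
  · intro j k hj hk hjk
    obtain ⟨h1, h2, h3⟩ := hd k _ (hdec k hk)
    obtain ⟨h1', h2', h3'⟩ := hd j _ (hdec j hj)
    rw [hjk] at h2' h3'
    have e : CMOp.counter (op j) = CMOp.counter (op k) := by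
      have a1 : op (d k) = _ := h2
      have a2 : op (d k) = _ := h2'
      rw [a1] at a2
      simpa using a2.symm
    have hj' := hdec j hj
    rw [e] at h3' hj'
    exact Nat.count_injective hj' (hdec k hk) (by rw [← h3, ← h3'])
  · intro k b hk hb hbk
    set i := CMOp.counter (op k) with hi
    have hk' : op k = Sum.inr (Sum.inr i) := hk
    have hb' : inc i b := hb
    have hz : (ρ k).2 i = 0 := by
      have := hop k
      rw [hk'] at this
      exact this.1
    have h1 := inv k i
    have h2 : Nat.count (inc i) b < Nat.count (inc i) k := Nat.count_strict_mono hb' hbk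
    obtain ⟨j, hj, h3, h4⟩ := exists_of_lt_count (p := dec i) (k := k)
      (m := Nat.count (inc i) b) (by omega)
    refine ⟨j, hj, ?_, ?_⟩
    · have h3' : op j = _ := h3
      show op j = Sum.inr (Sum.inl (CMOp.counter (op j)))
      rw [h3']; rfl
    · obtain ⟨h5, h6, h7⟩ := hd j i h3
      exact Nat.count_injective h6 hb' (by rw [h7, h4])

theorem enc_of_labels {l : List Instr} {q : ℕ} {t : ℕ → Instr} {d : ℕ → ℕ} (hl : ∀ k, t k ∈ l)
    (h0 : (t 0).1 = q) (hst : ∀ k, (t k).2.2 = (t (k+1)).1)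
    (hdec : ∀ k, isDec (t k) → d k < k ∧ isIncOf (t k) (t (d k)))
    (hinj : ∀ j k, isDec (t j) → isDec (t k) → d j = d k → j = k)
    (hzero : ∀ k b, isZero (t k) → isIncOf (t k) (t b) → b < k → ∃ j < k, isDec (t j) ∧ d j = b) :
    Enc (prodR0 (fun a b : WithTop ℕ => b < a)) (prodR1 (fun m n : ℕ => m ≠ n))
      (fun p => p.1 = (p.2 : WithTop ℕ)) (fun p => ∃ k : ℕ, p = ((k : WithTop ℕ), k + 1))
      (fun p => ∃ k : ℕ, isDec (t k) ∧ p = ((k : WithTop ℕ), d k))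
      (fun t' p => ∃ k : ℕ, p.1 = (k : WithTop ℕ) ∧ t k = t') q l ((⊤ : WithTop ℕ), 0) := by
  constructor
  · refine ⟨((0 : ℕ), 0), ⟨WithTop.coe_lt_top _, rfl⟩, rfl, ?_⟩
    rintro ⟨a, b⟩ ⟨h, _⟩
    simp at h
  · rintro ⟨a, b⟩ hy _ hs ⟨k, rfl⟩
    obtain ⟨hs1, hs2⟩ := hs
    have ha : a = ⊤ := by
      rcases hy with h | h
      · exact (congrArg Prod.fst h).symm
      · exact h.1.symm
    subst ha
    refine ⟨(((k+1 : ℕ) : WithTop ℕ), k+1), ⟨WithTop.coe_lt_top _, hs2⟩, rfl, ((k : ℕ), k+1),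
      ⟨?_, rfl⟩, k, rfl⟩
    exact WithTop.coe_lt_coe.2 (Nat.lt_succ_self k)
  · rintro y - ⟨a, b⟩ - hN ⟨a', b'⟩ ⟨h1, h2⟩ h3
    dsimp only at *
    subst hN; subst h1
    exact h2 (WithTop.coe_injective h3)
  · rintro y - ⟨a, b⟩ - hN ⟨a', b'⟩ ⟨h1, h2⟩ h3
    dsimp only at *
    subst hN h2 h3
    exact lt_irrefl _ h1
  · rintro y - _ - ⟨k, rfl⟩ _ ⟨h1, h2⟩ ⟨k', rfl⟩
    dsimp only at *
    have : k = k' := by omega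
    subst this
    exact lt_irrefl _ h1
  · rintro y - ⟨a, b⟩ - hN
    dsimp only at hN
    subst hN
    exact ⟨((b : ℕ), b+1), ⟨rfl, by simp⟩, b, rfl⟩
  · rintro y - ⟨a, b⟩ - hN ⟨a', b'⟩ ⟨h1, h2⟩ _ ⟨h3, h4⟩ ⟨k, rfl⟩
    dsimp only at *
    subst hN h2 h4
    obtain ⟨m, rfl⟩ := WithTop.ne_top_iff_exists.1 (ne_top_of_lt h1)
    have h1' := WithTop.coe_lt_coe.1 h1
    have h3' := WithTop.coe_lt_coe.1 h3
    dsimp at h1' h3'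
    omega
  · rintro y - _ - ⟨k, hk, rfl⟩ _ ⟨h1, h2⟩ ⟨k', hk', rfl⟩
    dsimp only at *
    have : k = k' := WithTop.coe_injective h1
    subst this
    exact h2 rfl
  · rintro y - _ - ⟨k, hk, rfl⟩ _ ⟨h1, h2⟩ ⟨k', hk', rfl⟩
    dsimp only at *
    have : k = k' := hinj _ _ hk hk' h2
    subst this
    exact lt_irrefl _ h1
  · rintro y - _ - ⟨k, hk, rfl⟩
    exact ⟨((d k : ℕ), d k), ⟨WithTop.coe_lt_coe.2 (hdec k hk).1, rfl⟩, rfl⟩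
  · rintro y - ⟨a, b⟩ - hN
    exact ⟨t b, hl b, b, hN, rfl⟩
  · rintro y - ⟨a, b⟩ - t1 - t2 - ⟨k, h1, rfl⟩ ⟨k', h2, rfl⟩
    have : k = k' := WithTop.coe_injective (h1.symm.trans h2)
    rw [this]
  · rintro y - ⟨a, b⟩ - t1 - t2 - hN ⟨k, h1, rfl⟩ _ ⟨h2, h3⟩ ⟨m, rfl⟩ ⟨a', b'⟩ ⟨h4, h5⟩ hN' ⟨k', h6, rfl⟩
    dsimp only at *
    subst h1 h3 h4
    have e1 : k = m + 1 := WithTop.coe_injective hN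
    have e2 : m = k' := WithTop.coe_injective h6
    subst e1 e2
    exact hst _
  · rintro y - ⟨a, b⟩ - t1 - hN ⟨k, h1, rfl⟩ hz
    dsimp only at *
    subst h1
    rcases Nat.eq_zero_or_pos k with rfl | hk
    · exact h0
    · exact absurd ⟨WithTop.coe_lt_coe.2 hk, rfl⟩ (hz (((0 : ℕ) : WithTop ℕ), b))
  · rintro y - _ - t1 - t2 - ⟨k, hk, rfl⟩ ⟨a, b⟩ ⟨h1, h2⟩ hN ⟨k', h3, rfl⟩ ⟨a', b'⟩ ⟨h4, h5⟩ hN' ⟨m, h6, rfl⟩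
    dsimp only at *
    subst h1 h5
    have e1 : k = k' := WithTop.coe_injective h3
    have e2 : d k = m := WithTop.coe_injective (hN'.symm.trans h6)
    subst e1 e2
    exact ⟨hk, (hdec k hk).2⟩
  · rintro y - ⟨a, b⟩ - t1 - hd hN ⟨k, h1, rfl⟩
    dsimp only at *
    have e1 : k = b := WithTop.coe_injective (h1.symm.trans hN)
    subst e1 h1
    exact ⟨((k : ℕ), d k), ⟨rfl, (hdec k hd).1.ne'⟩, k, hd, rfl⟩
  · rintro y - ⟨a, b⟩ - t1 - t2 - hz hi hN ⟨k, h1, rfl⟩ ⟨a', b'⟩ ⟨h2, h3⟩ ⟨a'', b''⟩ ⟨h4, h5⟩ hN' ⟨m, h6, rfl⟩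
    dsimp only at *
    subst h1 h2 h5
    have e1 : b' = m := WithTop.coe_injective (hN'.symm.trans h6)
    subst e1 h6
    obtain ⟨j, hj, h7, h8⟩ := hzero k _ hz hi (WithTop.coe_lt_coe.1 h4)
    exact ⟨((j : ℕ), b'), ⟨WithTop.coe_lt_coe.2 hj, rfl⟩, j, h7, by rw [h8]⟩

theorem LSat_of_run {L : Set BForm}
    (hframe : ∀ φ ∈ L, ProdValid (fun a b : WithTop ℕ => b < a) (fun m n : ℕ => m ≠ n) φ)
    {M : CMDesc} {q : ℕ} {ρ : ℕ → CMConfig} (h0 : ρ 0 = zeroConfig q)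
    (hs : ∀ n, CMStep M (ρ n) (ρ (n+1))) : LSat L (mainForm q M.2.2.2) := by
  obtain ⟨t, d, h1, h2, h3, h4, h5, h6⟩ := labels_of_run h0 hs
  have hE := enc_of_labels h1 h2 h3 h4 h5 h6
  let val : ℕ → WithTop ℕ × ℕ → Prop := fun n => match n with
    | 0 => fun p => p.1 = (p.2 : WithTop ℕ)
    | 1 => fun p => ∃ k : ℕ, p = ((k : WithTop ℕ), k + 1)
    | 2 => fun p => ∃ k : ℕ, isDec (t k) ∧ p = ((k : WithTop ℕ), d k)
    | m + 3 => fun p => ∃ k : ℕ, p.1 = (k : WithTop ℕ) ∧ Encodable.encode (t k) = m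
  refine ⟨_, inferInstance, _, _, val, fun ψ hψ w => hframe ψ hψ val w, ((⊤ : WithTop ℕ), 0), ?_⟩
  rw [sat_mainForm]
  have e : (fun t : Instr => val (3 + Encodable.encode t)) =
      (fun t' p => ∃ k : ℕ, p.1 = (k : WithTop ℕ) ∧ t k = t') := by
    funext t' p
    rw [Nat.add_comm]
    simp only [val, Encodable.encode_inj]
  rw [e]
  exact hE

theorem LSat_mainForm_iff {L : Set BForm} (hlog : IsLogic L)
    (hcomm : Commutator K43 DiffLogic ⊆ L)
    (hframe : ∀ φ ∈ L, ProdValid (fun a b : WithTop ℕ => b < a) (fun m n : ℕ => m ≠ n) φ)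
    (M : CMDesc) (q : ℕ) : LSat L (mainForm q M.2.2.2) ↔
      ∃ ρ : ℕ → CMConfig, ρ 0 = zeroConfig q ∧ ∀ n, CMStep M (ρ n) (ρ (n+1)) := by
  constructor
  · intro h
    obtain ⟨W, R0, R1, val, r, hF, hs⟩ := goodModel_of_LSat hlog hcomm h
    obtain ⟨t, D, h1, h2, h3, h4, h5, h6, h7, h8⟩ := exists_labels hF (sat_mainForm.1 hs)
    exact run_of_labels h1 h2 h3 h4 h5 h6 h7 h8 M rfl
  · rintro ⟨ρ, h0, hs⟩
    exact LSat_of_run hframe h0 hs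

end PartF

section PartA

/-! ## Computability of the reduction -/

theorem encodeB_injective : Function.Injective encodeB := by
  intro φ
  induction φ with
  | var n => intro ψ h; cases ψ <;> simp_all [encodeB]
  | neg φ ih =>
    intro ψ h; cases ψ <;> simp [encodeB] at h
    rw [ih h]
  | and φ χ ih1 ih2 =>
    intro ψ h; cases ψ <;> simp [encodeB] at h
    rw [ih1 h.1, ih2 h.2]
  | dia0 φ ih =>
    intro ψ h; cases ψ <;> simp [encodeB] at h
    rw [ih h]
  | dia1 φ ih =>
    intro ψ h; cases ψ <;> simp [encodeB] at h
    rw [ih h]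

/-- Primitive recursive families of formulas. -/
def PF {α : Type} [Primcodable α] (f : α → BForm) : Prop := Primrec fun a => encodeB (f a)

section
variable {α β : Type} [Primcodable α] [Primcodable β]

theorem PF.const (φ : BForm) : PF (fun _ : α => φ) := Primrec.const _

theorem PF.var {f : α → ℕ} (hf : Primrec f) : PF (fun a => .var (f a)) :=
  Primrec₂.natPair.comp (Primrec.const 0) hf

theorem PF.neg {f : α → BForm} (hf : PF f) : PF (fun a => .neg (f a)) :=
  Primrec₂.natPair.comp (Primrec.const 1) hf

theorem PF.and {f g : α → BForm} (hf : PF f) (hg : PF g) : PF (fun a => .and (f a) (g a)) :=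
  Primrec₂.natPair.comp (Primrec.const 2) (Primrec₂.natPair.comp hf hg)

theorem PF.dia0 {f : α → BForm} (hf : PF f) : PF (fun a => .dia0 (f a)) :=
  Primrec₂.natPair.comp (Primrec.const 3) hf

theorem PF.dia1 {f : α → BForm} (hf : PF f) : PF (fun a => .dia1 (f a)) :=
  Primrec₂.natPair.comp (Primrec.const 4) hf

theorem PF.imp {f g : α → BForm} (hf : PF f) (hg : PF g) : PF (fun a => .imp (f a) (g a)) :=
  (hf.and hg.neg).neg

theorem PF.box0 {f : α → BForm} (hf : PF f) : PF (fun a => .box0 (f a)) := hf.neg.dia0.neg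

theorem PF.box1 {f : α → BForm} (hf : PF f) : PF (fun a => .box1 (f a)) := hf.neg.dia1.neg

theorem PF.boxP1 {f : α → BForm} (hf : PF f) : PF (fun a => .boxP1 (f a)) := hf.and hf.box1

theorem PF.ite {c : α → Prop} [DecidablePred c] {f g : α → BForm} (hc : PrimrecPred c)
    (hf : PF f) (hg : PF g) : PF (fun a => if c a then f a else g a) := by
  refine (Primrec.ite hc hf hg).of_eq fun a => ?_
  by_cases h : c a <;> simp [h]

theorem PF.comp {f : β → BForm} {g : α → β} (hf : PF f) (hg : Primrec g) :
    PF (fun a => f (g a)) := Primrec.comp (f := fun b => encodeB (f b)) hf hg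

theorem PF.foldr {l : α → List β} {f : α → β → BForm} (hl : Primrec l)
    (hf : PF (fun p : α × β => f p.1 p.2)) :
    PF (fun a => (l a).foldr (fun b φ => .and (f a b) φ) .top) := by
  have h2 : Primrec₂ (fun (a : α) (p : β × ℕ) =>
      Nat.pair 2 (Nat.pair (encodeB (f a p.1)) p.2)) := by
    refine Primrec₂.natPair.comp (Primrec.const 2) (Primrec₂.natPair.comp ?_ ?_)
    · exact Primrec.comp (f := fun p : α × β => encodeB (f p.1 p.2)) hf (Primrec.pair Primrec.fst (Primrec.fst.comp Primrec.snd))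
    · exact Primrec.snd.comp Primrec.snd
  refine (Primrec.list_foldr hl (Primrec.const (encodeB .top)) h2).of_eq fun a => ?_
  dsimp only
  induction l a with
  | nil => rfl
  | cons b l ih => simp only [List.foldr_cons, ih]; rfl

theorem PF.bigAnd {l : α → List β} {f : α → β → BForm} (hl : Primrec l)
    (hf : PF (fun p : α × β => f p.1 p.2)) : PF (fun a => bigAnd ((l a).map (f a))) := by
  refine (PF.foldr hl hf).of_eq fun a => ?_
  show _ = encodeB (List.foldr _ _ _)
  rw [List.foldr_map]

theorem PF.bigNor {l : α → List β} {f : α → β → BForm} (hl : Primrec l)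
    (hf : PF (fun p : α × β => f p.1 p.2)) : PF (fun a => bigNor ((l a).map (f a))) := by
  refine (PF.foldr (f := fun a b => .neg (f a b)) hl hf.neg).of_eq fun a => ?_
  show _ = encodeB (List.foldr _ _ _)
  rw [List.foldr_map]

end

theorem primrec_counter : Primrec CMOp.counter := by
  have h : Primrec (fun o : CMOp => Sum.casesOn (motive := fun _ => ℕ) o (fun i => i)
      (fun o' => Sum.casesOn (motive := fun _ => ℕ) o' (fun i => i) (fun i => i))) := by
    refine Primrec.sumCasesOn Primrec.id Primrec.snd.to₂ ?_
    exact (Primrec.sumCasesOn Primrec.snd Primrec.snd.to₂ Primrec.snd.to₂).to₂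
  refine h.of_eq fun o => ?_
  rcases o with i | i | i <;> rfl

/-- Shorthand for the operation of an instruction. -/
theorem primrec_op : Primrec (fun t : Instr => t.2.1) := Primrec.fst.comp Primrec.snd

theorem primrec_ctr : Primrec (fun t : Instr => CMOp.counter t.2.1) :=
  primrec_counter.comp primrec_op

theorem primrec_isDec : PrimrecPred isDec :=
  Primrec.eq.comp primrec_op (Primrec.sumInr.comp (Primrec.sumInl.comp primrec_ctr))

theorem primrec_isZero : PrimrecPred isZero :=
  Primrec.eq.comp primrec_op (Primrec.sumInr.comp (Primrec.sumInr.comp primrec_ctr))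

theorem primrec_isIncOf : PrimrecPred (fun p : Instr × Instr => isIncOf p.1 p.2) :=
  Primrec.eq.comp (primrec_op.comp Primrec.snd) (Primrec.sumInl.comp (primrec_ctr.comp Primrec.fst))

theorem PF_fI : PF fI :=
  PF.var (Primrec.nat_add.comp (Primrec.const 3) Primrec.encode)

theorem PF_pairForm : PF (fun p : ℕ × Instr × Instr => pairForm p.1 p.2.1 p.2.2) := by
  have ht : Primrec (fun p : ℕ × Instr × Instr => p.2.1) := Primrec.fst.comp Primrec.snd
  have ht' : Primrec (fun p : ℕ × Instr × Instr => p.2.2) := Primrec.snd.comp Primrec.snd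
  have htt : Primrec (fun p : ℕ × Instr × Instr => p.2) := Primrec.snd
  have hI := PF_fI.comp ht
  have hI' := PF_fI.comp ht'
  have hN : PF (fun _ : ℕ × Instr × Instr => fN) := PF.const _
  have hS : PF (fun _ : ℕ × Instr × Instr => fS) := PF.const _
  have hC : PF (fun _ : ℕ × Instr × Instr => fC) := PF.const _
  have hT : PF (fun _ : ℕ × Instr × Instr => BForm.top) := PF.const _
  have hinc : PrimrecPred (fun p : ℕ × Instr × Instr => isIncOf p.2.1 p.2.2) :=
    primrec_isIncOf.comp htt
  have hdec : PrimrecPred (fun p : ℕ × Instr × Instr => isDec p.2.1) := primrec_isDec.comp ht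
  have hzero : PrimrecPred (fun p : ℕ × Instr × Instr => isZero p.2.1) := primrec_isZero.comp ht
  have hsrc : Primrec (fun p : ℕ × Instr × Instr => p.2.1.1) := Primrec.fst.comp ht
  have htgt : Primrec (fun p : ℕ × Instr × Instr => p.2.2.2.2) :=
    Primrec.snd.comp (Primrec.snd.comp ht')
  refine PF.and ?_ (PF.and ?_ (PF.and ?_ (PF.and ?_ (PF.and ?_ ?_))))
  · exact PF.ite (Primrec.eq.comp ht ht') hT (hI.and hI').neg
  · exact PF.ite (Primrec.eq.comp htgt hsrc) hT
      ((hN.and hI).and (hS.and (hN.and hI').dia1).dia0).neg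
  · exact PF.ite (Primrec.eq.comp hsrc Primrec.fst) hT ((hN.and hI).and hT.dia0.neg).neg
  · exact PF.ite (hdec.and hinc) hT (hC.and ((hN.and hI).dia1.and (hN.and hI').dia0)).neg
  · exact PF.ite hdec ((hN.and hI).imp hC.dia1) hT
  · exact PF.ite (hzero.and hinc)
      ((hN.and hI).and ((hN.and hI').dia0.and hC.dia0.neg).dia1).neg hT

theorem PF_mainForm : PF (fun p : ℕ × List Instr => mainForm p.1 p.2) := by
  refine PF.and (PF.const _) (PF.boxP1 (PF.box0 (PF.and (PF.const _) (PF.and ?_ ?_))))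
  · exact (PF.and (PF.const _) (PF.bigNor Primrec.snd (PF_fI.comp Primrec.snd))).neg
  · refine PF.bigAnd (f := fun (p : ℕ × List Instr) t => bigAnd (p.2.map fun t' => pairForm p.1 t t'))
      Primrec.snd ?_
    refine PF.bigAnd (f := fun (p : (ℕ × List Instr) × Instr) t' => pairForm p.1.1 p.2 t')
      (Primrec.snd.comp Primrec.fst) ?_
    exact PF_pairForm.comp (g := fun p : ((ℕ × List Instr) × Instr) × Instr => (p.1.1.1, p.1.2, p.2))
      (Primrec.pair (Primrec.fst.comp (Primrec.fst.comp Primrec.fst))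
        (Primrec.pair (Primrec.snd.comp Primrec.fst) Primrec.snd))

theorem primrec_mem : PrimrecPred (fun p : ℕ × List ℕ => p.1 ∈ p.2) := by
  have h : PrimrecRel fun (L : List ℕ) (b : ℕ) => ∃ a ∈ L, a = b :=
    PrimrecRel.exists_mem_list (R := fun a b : ℕ => a = b) Primrec.eq
  exact PrimrecPred.of_eq (h.comp Primrec.snd Primrec.fst) fun p => by simp

theorem primrec_CMWF : PrimrecPred CMWF := by
  have p1 : Primrec (fun M : CMDesc => M.1) := Primrec.fst
  have p2 : Primrec (fun M : CMDesc => M.2.1) := Primrec.fst.comp Primrec.snd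
  have p3 : Primrec (fun M : CMDesc => M.2.2.1) := Primrec.fst.comp (Primrec.snd.comp Primrec.snd)
  have p4 : Primrec (fun M : CMDesc => M.2.2.2) := Primrec.snd.comp (Primrec.snd.comp Primrec.snd)
  refine PrimrecPred.and ?_ (PrimrecPred.and ?_ (PrimrecPred.and ?_ ?_))
  · exact Primrec.nat_lt.comp (Primrec.const 1) p1
  · have h : PrimrecRel fun (L : List ℕ) (b : ℕ) => ∀ a ∈ L, a < b :=
      PrimrecRel.forall_mem_list (R := fun a b : ℕ => a < b) Primrec.nat_lt
    exact h.comp p3 p2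
  · have h0 : PrimrecRel fun (t : Instr) (M : CMDesc) => t.1 < M.2.1 ∧ t.1 ∉ M.2.2.1 ∧
        t.2.2 < M.2.1 ∧ CMOp.counter t.2.1 < M.1 := by
      have f : Primrec (fun p : Instr × CMDesc => p.1.1) := Primrec.fst.comp Primrec.fst
      have g : Primrec (fun p : Instr × CMDesc => p.1.2.2) :=
        Primrec.snd.comp (Primrec.snd.comp Primrec.fst)
      refine PrimrecPred.and ?_ (PrimrecPred.and ?_ (PrimrecPred.and ?_ ?_))
      · exact Primrec.nat_lt.comp f (p2.comp Primrec.snd)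
      · exact (primrec_mem.comp (Primrec.pair f (p3.comp Primrec.snd))).not
      · exact Primrec.nat_lt.comp g (p2.comp Primrec.snd)
      · exact Primrec.nat_lt.comp (primrec_ctr.comp Primrec.fst) (p1.comp Primrec.snd)
    exact (PrimrecRel.forall_mem_list h0).comp p4 Primrec.id
  · have h0 : PrimrecRel fun (t : Instr) (q : ℕ) => t.1 = q :=
      Primrec.eq.comp (Primrec.fst.comp Primrec.fst) Primrec.snd
    have h1 : PrimrecRel fun (q : ℕ) (M : CMDesc) => q ∈ M.2.2.1 ∨ ∃ t ∈ M.2.2.2, t.1 = q := by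
      refine PrimrecPred.or ?_ ?_
      · exact primrec_mem.comp (Primrec.pair Primrec.fst (p3.comp Primrec.snd))
      · exact (PrimrecRel.exists_mem_list h0).comp (p4.comp Primrec.snd) Primrec.fst
    refine PrimrecPred.of_eq ((PrimrecRel.forall_mem_list h1).comp (Primrec.list_range.comp p2)
      Primrec.id) fun M => ?_
    simp only [List.mem_range, id]
    exact forall_congr' fun q => imp_congr_right fun _ => or_iff_not_imp_left

open Classical in
theorem reduction {L : Set BForm} (hlog : IsLogic L)
    (hcomm : Commutator K43 DiffLogic ⊆ L)
    (hframe : ∀ φ ∈ L, ProdValid (fun a b : WithTop ℕ => b < a) (fun m n : ℕ => m ≠ n) φ) :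
    ManyOneReducible CMNonTerm (BCodes (LSat L)) := by
  let f : CMDesc × ℕ → BForm := fun p => if CMWF p.1 then mainForm p.2 p.1.2.2.2 else .bot
  have hf : PF f := by
    refine PF.ite (primrec_CMWF.comp Primrec.fst) ?_ (PF.const _)
    exact PF_mainForm.comp (g := fun p : CMDesc × ℕ => (p.2, p.1.2.2.2))
      (Primrec.pair Primrec.snd
        (Primrec.snd.comp (Primrec.snd.comp (Primrec.snd.comp Primrec.fst))))
  refine ⟨fun p => encodeB (f p), hf.to_comp, fun p => ?_⟩
  have h1 : BCodes (LSat L) (encodeB (f p)) ↔ LSat L (f p) := by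
    constructor
    · rintro ⟨φ, h, hφ⟩
      rwa [← encodeB_injective h]
    · exact fun h => ⟨_, rfl, h⟩
  rw [h1]
  by_cases hw : CMWF p.1
  · have : f p = mainForm p.2 p.1.2.2.2 := if_pos hw
    rw [this, LSat_mainForm_iff hlog hcomm hframe]
    exact ⟨fun h => h.2, fun h => ⟨hw, h⟩⟩
  · have : f p = .bot := if_neg hw
    rw [this]
    constructor
    · exact fun h => absurd h.1 hw
    · rintro ⟨W, _, R0, R1, val, _, w, hw⟩
      exact (sat_bot.1 hw).elim

end PartA

section PartB

/-! ## A small loop language over counters -/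

inductive Prog : Type
  | skip : Prog
  | inc : ℕ → Prog
  | seq : Prog → Prog → Prog
  | loop : ℕ → Prog → Prog

abbrev Store : Type := ℕ → ℕ

open Function (update)

inductive Exec : Prog → Store → Store → Prop
  | skip (s : Store) : Exec .skip s s
  | inc (i : ℕ) (s : Store) : Exec (.inc i) s (update s i (s i + 1))
  | seq {P Q : Prog} {s t u : Store} : Exec P s t → Exec Q t u → Exec (.seq P Q) s u
  | loop0 {i : ℕ} {P : Prog} {s : Store} : s i = 0 → Exec (.loop i P) s s
  | loopS {i : ℕ} {P : Prog} {s t u : Store} (k : ℕ) : s i = k + 1 → Exec P (update s i k) t →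
      Exec (.loop i P) t u → Exec (.loop i P) s u

theorem exec_loop {i : ℕ} {P : Prog} (Inv : ℕ → Store → Prop)
    (hstep : ∀ k u, u i = k + 1 → Inv (k+1) u →
      ∃ u', Exec P (update u i k) u' ∧ u' i = k ∧ Inv k u') :
    ∀ k u, u i = k → Inv k u → ∃ u', Exec (.loop i P) u u' ∧ u' i = 0 ∧ Inv 0 u' := by
  intro k
  induction k with
  | zero => exact fun u h0 h => ⟨u, .loop0 h0, h0, h⟩
  | succ k ih =>
    intro u h0 h
    obtain ⟨u', h1, h2, h3⟩ := hstep k u h0 h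
    obtain ⟨v, h4, h5, h6⟩ := ih u' h2 h3
    exact ⟨v, .loopS k h0 h1 h4, h5, h6⟩

theorem exec_clear (i : ℕ) (s : Store) :
    ∃ t, Exec (.loop i .skip) s t ∧ t i = 0 ∧ ∀ r, r ≠ i → t r = s r := by
  obtain ⟨t, h1, h2, h3⟩ := exec_loop (i := i) (P := .skip) (fun _ u => ∀ r, r ≠ i → u r = s r)
    (fun k u _ h => ⟨_, .skip _, by simp, fun r hr => by simp [hr, h r hr]⟩) (s i) s rfl
    (fun _ _ => rfl)
  exact ⟨t, h1, h2, h3⟩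

def copyP (x y z : ℕ) : Prog :=
  .seq (.loop y .skip) (.seq (.loop z .skip) (.seq (.loop x (.seq (.inc y) (.inc z)))
    (.loop z (.inc x))))

theorem exec_copy {x y z : ℕ} (hxy : x ≠ y) (hxz : x ≠ z) (hyz : y ≠ z) (s : Store) :
    ∃ t, Exec (copyP x y z) s t ∧ t y = s x ∧ ∀ r, r ≠ y → r ≠ z → t r = s r := by
  obtain ⟨s1, e1, a1, b1⟩ := exec_clear y s
  obtain ⟨s2, e2, a2, b2⟩ := exec_clear z s1
  obtain ⟨s3, e3, a3, b3, c3, d3⟩ := exec_loop (i := x) (P := .seq (.inc y) (.inc z))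
    (fun k u => u y + k = s x ∧ u z + k = s x ∧ ∀ r, r ≠ x → r ≠ y → r ≠ z → u r = s r)
    (by
      rintro k u hu ⟨h1, h2, h3⟩
      refine ⟨_, .seq (.inc _ _) (.inc _ _), ?_, ?_, ?_, ?_⟩
      · simp [hxy, hxz]
      · simp [hxy.symm, hyz]; omega
      · simp [hxz.symm, hyz.symm]; omega
      · intro r p1 p2 p3
        simp [p1, p2, p3, h3]) (s x) s2
    (by rw [b2 x hxz, b1 x hxy])
    ⟨by rw [b2 y hyz, a1, Nat.zero_add], by rw [a2, Nat.zero_add],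
      fun r _ h2 h3 => by rw [b2 r h3, b1 r h2]⟩
  obtain ⟨s4, e4, a4, b4, c4, d4⟩ := exec_loop (i := z) (P := .inc x)
    (fun k u => u y = s x ∧ u x + k = s x ∧ ∀ r, r ≠ x → r ≠ y → r ≠ z → u r = s r)
    (by
      rintro k u hu ⟨h1, h2, h3⟩
      refine ⟨_, .inc _ _, ?_, ?_, ?_, ?_⟩
      · simp [hxz.symm]
      · simp [hxy.symm, hyz, h1]
      · simp [hxz]; omega
      · intro r p1 p2 p3
        simp [p1, p3, h3 r p1 p2 p3]) (s3 z) s3 rfl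
    ⟨by omega, by omega, d3⟩
  refine ⟨s4, .seq e1 (.seq e2 (.seq e3 e4)), b4, fun r h1 h2 => ?_⟩
  by_cases hr : r = x
  · subst hr; omega
  · exact d4 r hr h1 h2

/-- `f` is computed by loop programs. -/
def LoopComp {n : ℕ} (f : List.Vector ℕ n → ℕ) : Prop :=
  ∀ (inp : Fin n → ℕ) (out base : ℕ), (∀ i, inp i < base ∧ inp i ≠ out) → out < base →
    ∃ P, ∀ s, ∃ t, Exec P s t ∧ t out = f (List.Vector.ofFn fun i => s (inp i)) ∧
      ∀ r, r < base → r ≠ out → t r = s r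

theorem loopComp_seq {m n : ℕ} (g : Fin n → List.Vector ℕ m → ℕ) (hg : ∀ i, LoopComp (g i))
    (inp : Fin m → ℕ) (base : ℕ) (hin : ∀ i, inp i < base) :
    ∀ k, k ≤ n → ∃ P, ∀ s, ∃ t, Exec P s t ∧
      (∀ i : Fin n, i.1 < k → t (base + i) = g i (List.Vector.ofFn fun j => s (inp j))) ∧
      ∀ r, r < base → t r = s r := by
  intro k
  induction k with
  | zero => exact fun _ => ⟨.skip, fun s => ⟨s, .skip s, fun i h => absurd h (by omega), fun _ _ => rfl⟩⟩
  | succ k ih =>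
    intro hk
    obtain ⟨P, hP⟩ := ih (by omega)
    obtain ⟨Q, hQ⟩ := hg ⟨k, by omega⟩ inp (base + k) (base + n)
      (fun i => by have := hin i; omega) (by omega)
    refine ⟨.seq P Q, fun s => ?_⟩
    obtain ⟨t, h1, h2, h3⟩ := hP s
    obtain ⟨u, h4, h5, h6⟩ := hQ t
    refine ⟨u, .seq h1 h4, fun i hi => ?_, fun r hr => ?_⟩
    · by_cases hik : i.1 = k
      · have : i = ⟨k, hk⟩ := Fin.ext hik
        subst this
        rw [h5]
        congr 2
        funext j
        exact h3 _ (hin j)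
      · rw [h6 _ (by omega) (by omega), h2 i (by omega)]
    · rw [h6 _ (by omega) (by omega), h3 r hr]

theorem loopComp_prec {n : ℕ} {f : List.Vector ℕ n → ℕ} {g : List.Vector ℕ (n+2) → ℕ}
    (hf : LoopComp f) (hg : LoopComp g) :
    LoopComp fun v : List.Vector ℕ (n+1) =>
      v.head.rec (f v.tail) fun y IH => g (y ::ᵥ IH ::ᵥ v.tail) := by
  intro inp out base hin hout
  obtain ⟨Pf, hPf⟩ := hf (fun i => inp i.succ) (base+2) (base+4)
    (fun i => by have := (hin i.succ).1; omega) (by omega)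
  obtain ⟨Pg, hPg⟩ := hg (Fin.cons (base+1) (Fin.cons (base+2) fun i => inp i.succ)) (base+3) (base+4)
    (by
      intro i
      refine Fin.cases ?_ (fun i => Fin.cases ?_ (fun i => ?_) i) i
      · simp only [Fin.cons_zero]; omega
      · simp only [Fin.cons_zero, Fin.cons_succ]; omega
      · simp only [Fin.cons_succ]; have := (hin i.succ).1; omega) (by omega)
  have h0 := (hin 0).1
  have h0' := (hin 0).2
  refine ⟨.seq (copyP (inp 0) base (base+4)) (.seq (.loop (base+1) .skip) (.seq Pf (.seq
    (.loop base (.seq Pg (.seq (copyP (base+3) (base+2) (base+4)) (.inc (base+1)))))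
    (copyP (base+2) out (base+4))))), fun s => ?_⟩
  obtain ⟨s1, e1, a1, b1⟩ := exec_copy (x := inp 0) (y := base) (z := base+4)
    (by omega) (by omega) (by omega) s
  obtain ⟨s2, e2, a2, b2⟩ := exec_clear (base+1) s1
  obtain ⟨s3, e3, a3, b3⟩ := hPf s2
  let v : List.Vector ℕ n := List.Vector.ofFn fun i => s (inp i.succ)
  let F : ℕ → ℕ := fun y => y.rec (f v) fun y IH => g (y ::ᵥ IH ::ᵥ v)
  have hs2 : ∀ r, r < base → s2 r = s r := fun r hr => by
    rw [b2 r (by omega), b1 r (by omega) (by omega)]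
  have hs3 : ∀ r, r < base → s3 r = s r := fun r hr => by
    rw [b3 r (by omega) (by omega), hs2 r hr]
  obtain ⟨s4, e4, a4, b4, c4, d4⟩ := exec_loop (i := base)
    (P := .seq Pg (.seq (copyP (base+3) (base+2) (base+4)) (.inc (base+1))))
    (fun k u => u (base+1) + k = s (inp 0) ∧ u (base+2) = F (u (base+1)) ∧ ∀ r, r < base → u r = s r)
    (by
      rintro k u hu ⟨h1, h2, h3⟩
      obtain ⟨u1, p1, q1, r1⟩ := hPg (update u base k)
      obtain ⟨u2, p2, q2, r2⟩ := exec_copy (x := base+3) (y := base+2) (z := base+4)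
        (by omega) (by omega) (by omega) u1
      have E : u1 (base+3) = F (u (base+1) + 1) := by
        rw [q1]
        show g _ = g _
        congr 1
        rw [List.Vector.ofFn]
        congr 1
        · simp
        rw [List.Vector.ofFn]
        congr 1
        · simpa using h2
        · show List.Vector.ofFn _ = List.Vector.ofFn _
          congr 1
          funext i
          have := (hin i.succ).1
          simp only [Fin.cons_succ]
          rw [Function.update_of_ne (by omega), h3 _ this]
      refine ⟨_, .seq p1 (.seq p2 (.inc _ _)), ?_, ?_, ?_, ?_⟩
      · rw [Function.update_of_ne (by omega), r2 _ (by omega) (by omega), r1 _ (by omega) (by omega)]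
        simp
      · rw [Function.update_self, r2 _ (by omega) (by omega), r1 _ (by omega) (by omega),
          Function.update_of_ne (by omega)]
        omega
      · rw [Function.update_self, Function.update_of_ne (by omega), q2, E,
          r2 _ (by omega) (by omega), r1 _ (by omega) (by omega), Function.update_of_ne (by omega)]
      · intro r hr
        rw [Function.update_of_ne (by omega), r2 _ (by omega) (by omega), r1 _ (by omega) (by omega),
          Function.update_of_ne (by omega), h3 r hr]) (s (inp 0)) s3
    (by rw [b3 _ (by omega) (by omega), b2 _ (by omega), a1])
    ⟨by rw [b3 _ (by omega) (by omega), a2, Nat.zero_add], by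
      have : s3 (base+1) = 0 := by rw [b3 _ (by omega) (by omega), a2]
      rw [this, a3]
      show f _ = f _
      congr 1
      show List.Vector.ofFn _ = List.Vector.ofFn _
      congr 1
      funext i
      exact hs2 _ (hin i.succ).1, hs3⟩
  obtain ⟨s5, e5, a5, b5⟩ := exec_copy (x := base+2) (y := out) (z := base+4)
    (by omega) (by omega) (by omega) s4
  refine ⟨s5, .seq e1 (.seq e2 (.seq e3 (.seq e4 e5))), ?_, fun r h1 h2 => ?_⟩
  · rw [a5, c4, show s4 (base+1) = s (inp 0) by omega]
    simp [F, v, List.Vector.ofFn]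
  · rw [b5 r h2 (by omega), d4 r h1]

theorem loopComp_of_primrec {n : ℕ} {f : List.Vector ℕ n → ℕ} (hf : Nat.Primrec' f) :
    LoopComp f := by
  induction hf with
  | zero =>
    intro inp out base hin hout
    refine ⟨.loop out .skip, fun s => ?_⟩
    obtain ⟨t, h1, h2, h3⟩ := exec_clear out s
    exact ⟨t, h1, h2, fun r _ hr => h3 r hr⟩
  | succ =>
    intro inp out base hin hout
    refine ⟨.seq (copyP (inp 0) out base) (.inc out), fun s => ?_⟩
    have h0 := hin 0
    obtain ⟨t, h1, h2, h3⟩ := exec_copy (x := inp 0) (y := out) (z := base)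
      (by omega) (by omega) (by omega) s
    refine ⟨_, .seq h1 (.inc _ _), ?_, fun r hr hr' => ?_⟩
    · simp [h2]
    · rw [Function.update_of_ne hr', h3 r hr' (by omega)]
  | get i =>
    intro inp out base hin hout
    have h0 := hin i
    refine ⟨copyP (inp i) out base, fun s => ?_⟩
    obtain ⟨t, h1, h2, h3⟩ := exec_copy (x := inp i) (y := out) (z := base)
      (by omega) (by omega) (by omega) s
    refine ⟨t, h1, ?_, fun r hr hr' => h3 r hr' (by omega)⟩
    simp [h2]
  | @comp m n f g _ _ ihf ihg =>
    intro inp out base hin hout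
    obtain ⟨P, hP⟩ := loopComp_seq g ihg inp base (fun i => (hin i).1) n le_rfl
    obtain ⟨Q, hQ⟩ := ihf (fun i => base + i) out (base + n)
      (fun i => by have := i.2; omega) (by omega)
    refine ⟨.seq P Q, fun s => ?_⟩
    obtain ⟨t, h1, h2, h3⟩ := hP s
    obtain ⟨u, h4, h5, h6⟩ := hQ t
    refine ⟨u, .seq h1 h4, ?_, fun r hr hr' => ?_⟩
    · rw [h5]
      congr 2
      funext i
      exact h2 i i.2
    · rw [h6 r (by omega) hr', h3 r hr]
  | prec _ _ ihf ihg => exact loopComp_prec ihf ihg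

end PartB

section PartG

/-! ## Compilation to counter machines -/

open Function (update)

def Prog.size : Prog → ℕ
  | .skip => 0
  | .inc _ => 1
  | .seq P Q => P.size + Q.size
  | .loop _ P => P.size + 2

/-- A strict bound for the counters used. -/
def Prog.bnd : Prog → ℕ
  | .skip => 0
  | .inc i => i + 1
  | .seq P Q => max P.bnd Q.bnd
  | .loop i P => max (i + 1) P.bnd

def opInc (i : ℕ) : CMOp := Sum.inl i
def opDec (i : ℕ) : CMOp := Sum.inr (Sum.inl i)
def opZero (i : ℕ) : CMOp := Sum.inr (Sum.inr i)

def Prog.compile : Prog → ℕ → List Instr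
  | .skip, _ => []
  | .inc i, a => [(a, opInc i, a + 1)]
  | .seq P Q, a => P.compile a ++ Q.compile (a + P.size)
  | .loop i P, a =>
    [(a, opDec i, a + 1), (a, opZero i, a + P.size + 2),
      (a + P.size + 1, opDec i, a + 1), (a + P.size + 1, opZero i, a + P.size + 2)] ++
      P.compile (a + 1)

theorem compile_range (P : Prog) : ∀ a, ∀ t ∈ P.compile a, a ≤ t.1 ∧ t.1 < a + P.size ∧
    a ≤ t.2.2 ∧ t.2.2 ≤ a + P.size ∧ CMOp.counter t.2.1 < P.bnd := by
  induction P with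
  | skip => intro a t ht; simp [Prog.compile] at ht
  | inc i =>
    intro a t ht
    simp only [Prog.compile, List.mem_singleton] at ht
    subst ht
    simp [Prog.size, Prog.bnd, opInc, CMOp.counter]
  | seq P Q ihP ihQ =>
    intro a t ht
    simp only [Prog.compile, List.mem_append] at ht
    simp only [Prog.size, Prog.bnd]
    rcases ht with ht | ht
    · have := ihP a t ht; omega
    · have := ihQ _ t ht; omega
  | loop i P ih =>
    intro a t ht
    simp only [Prog.compile, List.mem_append, List.mem_cons, List.not_mem_nil, or_false] at ht
    simp only [Prog.size, Prog.bnd]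
    rcases ht with (rfl | rfl | rfl | rfl) | ht
    · simp only [opDec, CMOp.counter]; omega
    · simp only [opZero, CMOp.counter]; omega
    · simp only [opDec, CMOp.counter]; omega
    · simp only [opZero, CMOp.counter]; omega
    · have := ih _ t ht; omega

theorem compile_total (P : Prog) : ∀ a q, a ≤ q → q < a + P.size → ∃ t ∈ P.compile a, t.1 = q := by
  induction P with
  | skip => intro a q h1 h2; simp [Prog.size] at h2; omega
  | inc i =>
    intro a q h1 h2
    simp only [Prog.size] at h2
    exact ⟨_, List.mem_singleton_self _, by dsimp only; omega⟩
  | seq P Q ihP ihQ =>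
    intro a q h1 h2
    simp only [Prog.size] at h2
    by_cases h : q < a + P.size
    · obtain ⟨t, ht, h'⟩ := ihP a q h1 h
      exact ⟨t, List.mem_append_left _ ht, h'⟩
    · obtain ⟨t, ht, h'⟩ := ihQ (a + P.size) q (by omega) (by omega)
      exact ⟨t, List.mem_append_right _ ht, h'⟩
  | loop i P ih =>
    intro a q h1 h2
    simp only [Prog.size] at h2
    by_cases h : q = a
    · exact ⟨(a, opDec i, a + 1), by simp [Prog.compile], h.symm⟩
    · by_cases h' : q = a + P.size + 1
      · exact ⟨(a + P.size + 1, opDec i, a + 1), by simp [Prog.compile], h'.symm⟩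
      · obtain ⟨t, ht, h''⟩ := ih (a+1) q (by omega) (by omega)
        exact ⟨t, List.mem_append_right _ ht, h''⟩

/-- Two instructions do not compete. -/
def Compat (t t' : Instr) : Prop :=
  t.1 = t'.1 → t = t' ∨ ∃ i, (t.2.1 = opDec i ∧ t'.2.1 = opZero i) ∨ (t.2.1 = opZero i ∧ t'.2.1 = opDec i)

def Det (l : List Instr) : Prop := ∀ t ∈ l, ∀ t' ∈ l, Compat t t'

theorem Compat.symm {t t' : Instr} (h : Compat t t') : Compat t' t := by
  intro he
  rcases h he.symm with h | ⟨i, h | h⟩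
  · exact Or.inl h.symm
  · exact Or.inr ⟨i, Or.inr ⟨h.2, h.1⟩⟩
  · exact Or.inr ⟨i, Or.inl ⟨h.2, h.1⟩⟩

theorem Det.append {l l' : List Instr} (h : Det l) (h' : Det l')
    (hd : ∀ t ∈ l, ∀ t' ∈ l', t.1 ≠ t'.1) : Det (l ++ l') := by
  intro t ht t' ht'
  rw [List.mem_append] at ht ht'
  rcases ht with ht | ht <;> rcases ht' with ht' | ht'
  · exact h t ht t' ht'
  · exact fun he => absurd he (hd t ht t' ht')
  · exact fun he => absurd he.symm (hd t' ht' t ht)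
  · exact h' t ht t' ht'

theorem det_single (t : Instr) : Det [t] := by
  intro a ha b hb
  rw [List.mem_singleton] at ha hb
  exact fun _ => Or.inl (ha.trans hb.symm)

theorem det_pair (q i a b : ℕ) : Det [(q, opDec i, a), (q, opZero i, b)] := by
  intro t ht t' ht'
  simp only [List.mem_cons, List.not_mem_nil, or_false] at ht ht'
  rcases ht with rfl | rfl <;> rcases ht' with rfl | rfl
  · exact fun _ => Or.inl rfl
  · exact fun _ => Or.inr ⟨i, Or.inl ⟨rfl, rfl⟩⟩
  · exact fun _ => Or.inr ⟨i, Or.inr ⟨rfl, rfl⟩⟩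
  · exact fun _ => Or.inl rfl

theorem compile_det (P : Prog) : ∀ a, Det (P.compile a) := by
  induction P with
  | skip => intro a t ht; simp [Prog.compile] at ht
  | inc i => exact fun a => det_single _
  | seq P Q ihP ihQ =>
    intro a
    refine (ihP a).append (ihQ _) fun t ht t' ht' => ?_
    have h1 := compile_range P _ t ht
    have h2 := compile_range Q _ t' ht'
    omega
  | loop i P ih =>
    intro a
    refine Det.append (Det.append (det_pair a i _ _) (det_pair (a + P.size + 1) i _ _) ?_) (ih _) ?_
    · intro t ht t' ht'
      simp only [List.mem_cons, List.not_mem_nil, or_false] at ht ht'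
      rcases ht with rfl | rfl <;> rcases ht' with rfl | rfl <;> dsimp only <;> omega
    · intro t ht t' ht'
      have h2 := compile_range P _ t' ht'
      simp only [List.mem_cons, List.not_mem_nil, or_false] at ht
      rcases ht with rfl | rfl | rfl | rfl <;> dsimp only <;> omega

theorem step_inc {M : CMDesc} {q i q' : ℕ} (h : (q, opInc i, q') ∈ M.2.2.2) (s : Store) :
    CMStep M (q, s) (q', update s i (s i + 1)) :=
  ⟨opInc i, q', h, rfl, by
    show update s i (s i + 1) i = s i + 1 ∧ ∀ j, j ≠ i → update s i (s i + 1) j = s j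
    exact ⟨by simp, fun j hj => by simp [hj]⟩⟩

theorem step_dec {M : CMDesc} {q i q' k : ℕ} (h : (q, opDec i, q') ∈ M.2.2.2) {s : Store}
    (hs : s i = k + 1) : CMStep M (q, s) (q', update s i k) :=
  ⟨opDec i, q', h, rfl, by
    show 0 < s i ∧ update s i k i + 1 = s i ∧ ∀ j, j ≠ i → update s i k j = s j
    exact ⟨by omega, by simp [hs], fun j hj => by simp [hj]⟩⟩

theorem step_zero {M : CMDesc} {q i q' : ℕ} (h : (q, opZero i, q') ∈ M.2.2.2) {s : Store}
    (hs : s i = 0) : CMStep M (q, s) (q', s) :=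
  ⟨opZero i, q', h, rfl, by
    show s i = 0 ∧ ∀ j, s j = s j
    exact ⟨hs, fun _ => rfl⟩⟩

theorem reach_of_exec {M : CMDesc} {P : Prog} {s t : Store} (h : Exec P s t) :
    ∀ a, (∀ x ∈ P.compile a, x ∈ M.2.2.2) →
      Relation.ReflTransGen (CMStep M) (a, s) (a + P.size, t) ∧
      ∀ i B, P = .loop i B → Relation.ReflTransGen (CMStep M) (a + B.size + 1, s) (a + P.size, t) := by
  induction h with
  | skip s => exact fun a _ => ⟨.refl, fun i B h => by simp at h⟩
  | inc i s =>
    exact fun a ha => ⟨.single (step_inc (ha _ (List.mem_singleton_self _)) s),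
      fun i B h => by simp at h⟩
  | @seq P Q s t u _ _ ih1 ih2 =>
    intro a ha
    refine ⟨?_, fun i B h => by simp at h⟩
    have h1 := (ih1 a fun x hx => ha x (List.mem_append_left _ hx)).1
    have h2 := (ih2 (a + P.size) fun x hx => ha x (List.mem_append_right _ hx)).1
    rw [Nat.add_assoc] at h2
    exact h1.trans h2
  | @loop0 i P s hs =>
    intro a ha
    constructor
    · exact .single (step_zero (i := i) (ha _ (by simp [Prog.compile, Prog.size]; omega)) hs)
    · intro i' B h
      simp only [Prog.loop.injEq] at h
      obtain ⟨rfl, rfl⟩ := h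
      exact .single (step_zero (i := i) (ha _ (by simp [Prog.compile, Prog.size]; omega)) hs)
  | @loopS i P s t u k hs _ _ ih1 ih2 =>
    intro a ha
    have h1 := (ih1 (a+1) fun x hx => ha x (List.mem_append_right _ hx)).1
    have h2 := (ih2 a ha).2 i P rfl
    rw [show a + 1 + P.size = a + P.size + 1 by omega] at h1
    constructor
    · exact .head (step_dec (i := i) (ha _ (by simp [Prog.compile])) hs) (h1.trans h2)
    · intro i' B h
      simp only [Prog.loop.injEq] at h
      obtain ⟨rfl, rfl⟩ := h
      exact .head (step_dec (i := i) (ha _ (by simp [Prog.compile])) hs) (h1.trans h2)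

theorem step_det {M : CMDesc} (hM : Det M.2.2.2) {σ τ τ' : CMConfig} (h : CMStep M σ τ)
    (h' : CMStep M σ τ') : τ = τ' := by
  obtain ⟨op, q, hm, hq, hop⟩ := h
  obtain ⟨op', q', hm', hq', hop'⟩ := h'
  rcases hM _ hm _ hm' rfl with h | ⟨i, h | h⟩
  · simp only [Prod.mk.injEq, true_and] at h
    obtain ⟨rfl, rfl⟩ := h
    refine Prod.ext (hq.trans hq'.symm) ?_
    funext j
    rcases op with i | i | i
    · by_cases hj : j = i
      · subst hj; rw [hop.1, hop'.1]
      · rw [hop.2 j hj, hop'.2 j hj]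
    · by_cases hj : j = i
      · subst hj; have := hop.2.1; have := hop'.2.1; omega
      · rw [hop.2.2 j hj, hop'.2.2 j hj]
    · rw [hop.2 j, hop'.2 j]
  · obtain ⟨h1, h2⟩ := h
    dsimp only at h1 h2
    subst h1 h2
    have a := hop.1
    have b := hop'.1
    omega
  · obtain ⟨h1, h2⟩ := h
    dsimp only at h1 h2
    subst h1 h2
    have a := hop.1
    have b := hop'.1
    omega

theorem no_run {M : CMDesc} (hM : Det M.2.2.2) {σ τ : CMConfig}
    (h : Relation.ReflTransGen (CMStep M) σ τ) (hτ : ∀ τ', ¬ CMStep M τ τ') :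
    ¬ ∃ ρ : ℕ → CMConfig, ρ 0 = σ ∧ ∀ n, CMStep M (ρ n) (ρ (n+1)) := by
  rintro ⟨ρ, h0, hs⟩
  have : ∃ n, ρ n = τ := by
    clear hτ
    induction h with
    | refl => exact ⟨0, h0⟩
    | tail _ hst ih =>
      obtain ⟨n, rfl⟩ := ih
      exact ⟨n+1, step_det hM (hs n) hst⟩
  obtain ⟨n, rfl⟩ := this
  exact hτ _ (hs n)

theorem run_of_progress {M : CMDesc} (G : CMConfig → Prop)
    (hG : ∀ σ, G σ → ∃ σ', Relation.TransGen (CMStep M) σ σ' ∧ G σ') {σ τ : CMConfig}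
    (h : Relation.ReflTransGen (CMStep M) σ τ) (hτ : G τ) :
    ∃ ρ : ℕ → CMConfig, ρ 0 = σ ∧ ∀ n, CMStep M (ρ n) (ρ (n+1)) := by
  have key : ∀ x : {σ // ∃ τ, Relation.ReflTransGen (CMStep M) σ τ ∧ G τ},
      ∃ y : {σ // ∃ τ, Relation.ReflTransGen (CMStep M) σ τ ∧ G τ}, CMStep M x.1 y.1 := by
    rintro ⟨σ, τ, h, hτ⟩
    obtain ⟨τ', h', hτ'⟩ := hG τ hτ
    obtain ⟨c, h1, h2⟩ := Relation.TransGen.head'_iff.1 (Relation.TransGen.trans_right h h')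
    exact ⟨⟨c, τ', h2, hτ'⟩, h1⟩
  choose f hf using key
  refine ⟨fun n => (f^[n] ⟨σ, τ, h, hτ⟩).1, rfl, fun n => ?_⟩
  dsimp only
  rw [Function.iterate_succ_apply']
  exact hf _

end PartG

section PartH

/-! ## Undecidability of counter machine non-termination -/

open Function (update)

/-- The part of the machine independent of the input: search for `k` with `f n k ≠ 0`. -/
def coreInstr (P : Prog) : List Instr :=
  P.compile 1 ++ ([(1 + P.size, opDec 2, 0), (1 + P.size, opZero 2, 2 + P.size)] ++
    ([(2 + P.size, opInc 1, 1)] ++ [(3 + P.size, opZero 2, 1)]))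

/-- Loading the input into counter `0`. -/
def loadInstr (m n : ℕ) : List Instr :=
  (List.range n).map fun j => (m + j + 1, opInc 0, m + j)

def searchM (P : Prog) (n : ℕ) : CMDesc :=
  (3 + P.bnd, 4 + P.size + n, [0], coreInstr P ++ loadInstr (3 + P.size) n)

theorem mem_loadInstr {m n : ℕ} {t : Instr} :
    t ∈ loadInstr m n ↔ ∃ j < n, t = (m + j + 1, opInc 0, m + j) := by
  simp only [loadInstr, List.mem_map, List.mem_range, eq_comm]

theorem mem_coreInstr {P : Prog} {t : Instr} : t ∈ coreInstr P ↔ t ∈ P.compile 1 ∨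
    t = (1 + P.size, opDec 2, 0) ∨ t = (1 + P.size, opZero 2, 2 + P.size) ∨
    t = (2 + P.size, opInc 1, 1) ∨ t = (3 + P.size, opZero 2, 1) := by
  simp only [coreInstr, List.mem_append, List.mem_cons, List.not_mem_nil, or_false, or_assoc]

theorem coreInstr_range {P : Prog} {t : Instr} (ht : t ∈ coreInstr P) :
    1 ≤ t.1 ∧ t.1 ≤ 3 + P.size ∧ t.2.2 ≤ 3 + P.size ∧ CMOp.counter t.2.1 < 3 + P.bnd := by
  rw [mem_coreInstr] at ht
  rcases ht with ht | rfl | rfl | rfl | rfl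
  · have := compile_range P _ t ht; omega
  all_goals simp only [opDec, opZero, opInc, CMOp.counter]; omega

theorem searchM_wf (P : Prog) (n : ℕ) : CMWF (searchM P n) := by
  refine ⟨?_, ?_, ?_, ?_⟩
  · show 1 < 3 + P.bnd; omega
  · intro q hq
    have : q = 0 := List.mem_singleton.1 hq
    show q < 4 + P.size + n
    omega
  · intro t ht
    show t.1 < 4 + P.size + n ∧ t.1 ∉ [0] ∧ t.2.2 < 4 + P.size + n ∧ CMOp.counter t.2.1 < 3 + P.bnd
    rw [List.mem_singleton]
    rcases List.mem_append.1 ht with ht | ht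
    · have := coreInstr_range ht; omega
    · obtain ⟨j, hj, rfl⟩ := mem_loadInstr.1 ht
      simp only [opInc, CMOp.counter]; omega
  · intro q hq hq'
    replace hq' : q ≠ 0 := fun h => hq' (List.mem_singleton.2 h)
    replace hq : q < 4 + P.size + n := hq
    have hc : ∀ t, t ∈ coreInstr P → t ∈ (searchM P n).2.2.2 := fun t ht => List.mem_append_left _ ht
    by_cases h1 : q < 1 + P.size
    · obtain ⟨t, ht, h⟩ := compile_total P 1 q (by omega) h1
      exact ⟨t, hc t (mem_coreInstr.2 (Or.inl ht)), h⟩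
    by_cases h2 : q = 1 + P.size
    · exact ⟨_, hc _ (mem_coreInstr.2 (Or.inr (Or.inl rfl))), h2.symm⟩
    by_cases h3 : q = 2 + P.size
    · exact ⟨_, hc _ (mem_coreInstr.2 (Or.inr (Or.inr (Or.inr (Or.inl rfl))))), h3.symm⟩
    by_cases h4 : q = 3 + P.size
    · exact ⟨_, hc _ (mem_coreInstr.2 (Or.inr (Or.inr (Or.inr (Or.inr rfl))))), h4.symm⟩
    refine ⟨_, List.mem_append_right _ (mem_loadInstr.2 ⟨q - (4 + P.size), by omega, rfl⟩), ?_⟩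
    dsimp only; omega

theorem searchM_det (P : Prog) (n : ℕ) : Det (searchM P n).2.2.2 := by
  refine Det.append ?_ ?_ ?_
  · refine (compile_det P 1).append ((det_pair _ _ _ _).append
      ((det_single _).append (det_single _) ?_) ?_) ?_
    · intro t ht t' ht'
      simp only [List.mem_singleton] at ht ht'
      subst ht ht'
      dsimp only; omega
    · intro t ht t' ht'
      simp only [List.mem_cons, List.mem_append, List.not_mem_nil, or_false] at ht ht'
      rcases ht with rfl | rfl <;> rcases ht' with rfl | rfl <;> dsimp only <;> omega
    · intro t ht t' ht'
      have := compile_range P _ t ht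
      simp only [List.mem_cons, List.mem_append, List.not_mem_nil, or_false] at ht'
      rcases ht' with (rfl | rfl) | rfl | rfl <;> dsimp only <;> omega
  · intro t ht t' ht' he
    obtain ⟨j, hj, rfl⟩ := mem_loadInstr.1 ht
    obtain ⟨j', hj', rfl⟩ := mem_loadInstr.1 ht'
    dsimp only at he
    have : j = j' := by omega
    exact Or.inl (by rw [this])
  · intro t ht t' ht'
    have := coreInstr_range ht
    obtain ⟨j, hj, rfl⟩ := mem_loadInstr.1 ht'
    dsimp only; omega

theorem searchM_load (P : Prog) (n : ℕ) : ∀ j, j ≤ n → ∃ s : Store, s 0 = j ∧ (∀ r, r ≠ 0 → s r = 0) ∧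
    Relation.ReflTransGen (CMStep (searchM P n)) (zeroConfig (3 + P.size + n))
      (3 + P.size + (n - j), s) := by
  intro j
  induction j with
  | zero => exact fun _ => ⟨fun _ => 0, rfl, fun _ _ => rfl, .refl⟩
  | succ j ih =>
    intro hj
    obtain ⟨s, h0, h1, h2⟩ := ih (by omega)
    refine ⟨update s 0 (s 0 + 1), by simp [h0], fun r hr => by simp [hr, h1], h2.tail ?_⟩
    refine step_inc (List.mem_append_right _ (mem_loadInstr.2 ⟨n - (j+1), by omega, ?_⟩)) s
    rw [show 3 + P.size + (n - j) = 3 + P.size + (n - (j+1)) + 1 by omega]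

theorem searchM_spec {P : Prog} {f : ℕ → ℕ → ℕ}
    (hP : ∀ s, ∃ t, Exec P s t ∧ t 2 = f (s 0) (s 1) ∧ ∀ r, r < 3 → r ≠ 2 → t r = s r) (n : ℕ) :
    CMNonTerm (searchM P n, 3 + P.size + n) ↔ ∀ k, f n k = 0 := by
  have hc : ∀ t, t ∈ coreInstr P → t ∈ (searchM P n).2.2.2 := fun t ht => List.mem_append_left _ ht
  obtain ⟨s0, h0, h1, h2⟩ := searchM_load P n n le_rfl
  have hstart : ∃ s : Store, s 0 = n ∧ s 1 = 0 ∧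
      Relation.ReflTransGen (CMStep (searchM P n)) (zeroConfig (3 + P.size + n)) (1, s) := by
    refine ⟨s0, h0, h1 1 (by omega), h2.tail ?_⟩
    rw [Nat.sub_self, Nat.add_zero]
    exact step_zero (i := 2) (hc _ (mem_coreInstr.2 (Or.inr (Or.inr (Or.inr (Or.inr rfl))))))
      (h1 2 (by omega))
  have hrun : ∀ s : Store, s 0 = n → ∃ t : Store, t 0 = n ∧ t 1 = s 1 ∧ t 2 = f n (s 1) ∧
      Relation.ReflTransGen (CMStep (searchM P n)) (1, s) (1 + P.size, t) := by
    intro s hs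
    obtain ⟨t, e1, e2, e3⟩ := hP s
    refine ⟨t, by rw [e3 0 (by omega) (by omega), hs], by rw [e3 1 (by omega) (by omega)],
      by rw [e2, hs], ?_⟩
    exact (reach_of_exec e1 1 fun x hx => hc _ (mem_coreInstr.2 (Or.inl hx))).1
  have hloop : ∀ s : Store, s 0 = n → f n (s 1) = 0 → ∃ t : Store, t 0 = n ∧ t 1 = s 1 + 1 ∧
      Relation.TransGen (CMStep (searchM P n)) (1, s) (1, t) := by
    intro s hs hf
    obtain ⟨t, a, b, c, d⟩ := hrun s hs
    refine ⟨update t 1 (t 1 + 1), by simp [a], by simp [b], ?_⟩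
    refine Relation.TransGen.tail' (d.tail (step_zero (i := 2) (q' := 2 + P.size)
      (hc _ (mem_coreInstr.2 (Or.inr (Or.inr (Or.inl rfl))))) (c.trans hf))) ?_
    exact step_inc (hc _ (mem_coreInstr.2 (Or.inr (Or.inr (Or.inr (Or.inl rfl)))))) t
  constructor
  · rintro ⟨_, hr⟩
    by_contra hne
    push Not at hne
    classical
    let k0 := Nat.find hne
    have hk0 : f n k0 ≠ 0 := Nat.find_spec hne
    have hlt : ∀ k, k < k0 → f n k = 0 := fun k hk => by
      by_contra h; exact Nat.find_min hne hk h
    have hreach : ∀ k, k ≤ k0 → ∃ s : Store, s 0 = n ∧ s 1 = k ∧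
        Relation.ReflTransGen (CMStep (searchM P n)) (zeroConfig (3 + P.size + n)) (1, s) := by
      intro k
      induction k with
      | zero => exact fun _ => hstart
      | succ k ih =>
        intro hk
        obtain ⟨s, a, b, c⟩ := ih (by omega)
        obtain ⟨t, a', b', c'⟩ := hloop s a (by rw [b]; exact hlt k (by omega))
        exact ⟨t, a', by rw [b', b], c.trans c'.to_reflTransGen⟩
    obtain ⟨s, a, b, c⟩ := hreach k0 le_rfl
    obtain ⟨t, a', b', c', d'⟩ := hrun s a
    obtain ⟨x, hx⟩ := Nat.exists_eq_succ_of_ne_zero hk0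
    have hstep := step_dec (M := searchM P n) (q := 1 + P.size) (i := 2) (q' := 0) (s := t) (k := x)
      (hc _ (mem_coreInstr.2 (Or.inr (Or.inl rfl)))) (by rw [c', b, hx])
    refine no_run (searchM_det P n) ((c.trans d').tail hstep) ?_ hr
    rintro τ ⟨op, q', hm, _⟩
    have := ((searchM_wf P n).2.2.1 _ hm).2.1
    exact this (List.mem_singleton.2 rfl)
  · intro hf
    refine ⟨searchM_wf P n, ?_⟩
    obtain ⟨s, a, b, c⟩ := hstart
    refine run_of_progress (fun σ => σ.1 = 1 ∧ σ.2 0 = n) ?_ c ⟨rfl, a⟩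
    rintro ⟨q, s⟩ ⟨hq, hs⟩
    dsimp only at hq hs
    subst hq
    obtain ⟨t, a, b, c⟩ := hloop s hs (hf _)
    exact ⟨_, c, rfl, a⟩

theorem CMNonTerm_undecidable : ¬ ComputablePred CMNonTerm := by
  intro hC
  let f : ℕ → ℕ → ℕ := fun n k =>
    if ((Nat.Partrec.Code.ofNatCode n).evaln k 0).isSome = true then 1 else 0
  have hf : Primrec₂ f := by
    have h1 : Primrec (fun p : ℕ × ℕ => (Nat.Partrec.Code.ofNatCode p.1).evaln p.2 0) := by
      have h := Nat.Partrec.Code.primrec_evaln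
      exact h.comp (Primrec.pair (Primrec.pair Primrec.snd
        ((Primrec.ofNat Nat.Partrec.Code).comp Primrec.fst)) (Primrec.const 0))
    exact Primrec.ite (Primrec.eq.comp (Primrec.option_isSome.comp h1) (Primrec.const true))
      (Primrec.const 1) (Primrec.const 0)
  have hL := loopComp_of_primrec (Nat.Primrec'.prim_iff₂.2 hf)
  obtain ⟨P, hP⟩ := hL (fun i => i.1) 2 3 (fun i => by have := i.2; omega) (by omega)
  have hP' : ∀ s, ∃ t, Exec P s t ∧ t 2 = f (s 0) (s 1) ∧ ∀ r, r < 3 → r ≠ 2 → t r = s r := by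
    intro s
    obtain ⟨t, h1, h2, h3⟩ := hP s
    exact ⟨t, h1, by rw [h2]; rfl, h3⟩
  let g : Nat.Partrec.Code → CMDesc × ℕ := fun c =>
    (searchM P (Encodable.encode c), 3 + P.size + Encodable.encode c)
  have hg : Computable g := by
    have he : Primrec (fun c : Nat.Partrec.Code => Encodable.encode c) := Primrec.encode
    have hload : Primrec (fun n : ℕ => loadInstr (3 + P.size) n) := by
      refine Primrec.list_map Primrec.list_range ?_
      have hadd : Primrec (fun p : ℕ × ℕ => 3 + P.size + p.2) :=
        Primrec.nat_add.comp (Primrec.const _) Primrec.snd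
      exact (Primrec.pair (Primrec.succ.comp hadd) (Primrec.pair (Primrec.const _) hadd)).to₂
    refine Primrec.to_comp ?_
    refine Primrec.pair (Primrec.pair (Primrec.const _) (Primrec.pair ?_
      (Primrec.pair (Primrec.const _) ?_))) ?_
    · exact Primrec.nat_add.comp (Primrec.const _) he
    · exact Primrec.list_append.comp (Primrec.const _) (hload.comp he)
    · exact Primrec.nat_add.comp (Primrec.const _) he
  have hred : ComputablePred (fun c => CMNonTerm (g c)) := hC.computable_of_manyOneReducible ⟨g, hg, fun _ => Iff.rfl⟩
  refine ComputablePred.halting_problem 0 (hred.not.of_eq fun c => ?_)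
  rw [searchM_spec hP']
  have hfc : ∀ k, f (Encodable.encode c) k = 0 ↔ c.evaln k 0 = none := by
    intro k
    have : Nat.Partrec.Code.ofNatCode (Encodable.encode c) = c := Denumerable.ofNat_encode c
    simp [f, this]
  simp only [hfc]
  rw [Part.dom_iff_mem]
  constructor
  · intro h
    push Not at h
    obtain ⟨k, hk⟩ := h
    obtain ⟨x, hx⟩ := Option.ne_none_iff_exists'.1 hk
    exact ⟨x, Nat.Partrec.Code.evaln_sound hx⟩
  · rintro ⟨x, hx⟩ h
    obtain ⟨k, hk⟩ := Nat.Partrec.Code.evaln_complete.1 hx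
    rw [h k] at hk
    simp at hk

end PartH

/-- For any bimodal logic `L` containing the commutator `[K4.3,Diff]`
such that the product frame `⟨ω+1,>⟩ × ⟨ω,≠⟩` is a frame for `L`, the
`L`-satisfiability problem is undecidable, via a computable many-one reduction of
counter-machine non-termination. -/
theorem commutator_extension_undecidable (L : Set BForm) (hlog : IsLogic L)
    (hcomm : Commutator K43 DiffLogic ⊆ L)
    (hframe : ∀ φ ∈ L, ProdValid (fun a b : WithTop ℕ => b < a) (fun m n : ℕ => m ≠ n) φ) :
    ¬ ComputablePred (BCodes (LSat L)) ∧
    ManyOneReducible CMNonTerm (BCodes (LSat L)) := by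
  have hr := reduction hlog hcomm hframe
  exact ⟨fun h => CMNonTerm_undecidable (h.computable_of_manyOneReducible hr), hr⟩

end HK
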